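/- Let (R,μ) be a non-atomic σ-finite measure space with μ(R) > 0, let B be a Young function, and let 1 < r < s ≤ ∞. Then the continuous embedding L^{r,s} ↪ L^B holds (i.e. there is C > 0 with ‖f‖_B ≤ C‖f‖_{r,s} for all f) if and only if ∫_{1/μ(R)}^∞ (B(t)/t^r)^{s/(s−r)} dt/t < ∞, where the exponent s/(s−r) is interpreted as 1 when s = ∞, and with the convention 1/∞ = 0. -/

import Mathlib

open MeasureTheory Filter Set ENNReal

noncomputable section

/-- A Young function: a convex, non-decreasing, left-continuous function
`A : [0,∞] → [0,∞]` with `A(0) = 0`, `A(0+) = 0` and `A(∞) = ∞`. -/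
structure YoungFunction where
  toFun : ℝ≥0∞ → ℝ≥0∞
  map_zero : toFun 0 = 0
  tendsto_zero : Filter.Tendsto toFun (nhdsWithin 0 (Set.Ioi 0)) (nhds 0)
  mono : Monotone toFun
  convex' : ∀ s t c : ℝ≥0∞, c ≤ 1 →
    toFun (c * s + (1 - c) * t) ≤ c * toFun s + (1 - c) * toFun t
  left_continuous : ∀ t : ℝ≥0∞, 0 < t → toFun t = ⨆ s ∈ Set.Iio t, toFun s
  map_top : toFun ⊤ = ⊤

/-- Left-continuous inverse of a non-decreasing function `F : [0,∞] → [0,∞]`: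
`F⁻¹(t) = inf {τ ≥ 0 : F(τ) ≥ t}`. -/
def leftInvE (F : ℝ≥0∞ → ℝ≥0∞) (t : ℝ≥0∞) : ℝ≥0∞ :=
  sInf {τ : ℝ≥0∞ | t ≤ F τ}

/-- `a` is the right-continuous derivative of the Young function `A`:
`a` is non-decreasing, right-continuous, `a(∞) = ∞`, and
`A(t) = ∫₀ᵗ a(s) ds` for all finite `t ≥ 0`. -/
def IsYoungDerivative (A : YoungFunction) (a : ℝ≥0∞ → ℝ≥0∞) : Prop :=
  Monotone a ∧ a ⊤ = ⊤ ∧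
    (∀ t : ℝ≥0∞, t ≠ ⊤ → Filter.Tendsto a (nhdsWithin t (Set.Ioi t)) (nhds (a t))) ∧
    ∀ t : ℝ, 0 ≤ t →
      A.toFun (ENNReal.ofReal t) = ∫⁻ s in Set.Ioc (0:ℝ) t, a (ENNReal.ofReal s)

/-- The Young conjugate `B̃(t) = sup {s·t − B(s) : s ∈ [0,∞]}`. -/
def youngConj (A : YoungFunction) (t : ℝ≥0∞) : ℝ≥0∞ :=
  ⨆ s : ℝ≥0∞, s * t - A.toFun s

variable {R : Type*} [MeasurableSpace R]

/-- The distribution function `f₊(λ) = μ({x : |f(x)| > λ})`. -/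
def distFn (μ : Measure R) (f : R → ℝ) (lam : ℝ≥0∞) : ℝ≥0∞ :=
  μ {x | lam < ENNReal.ofReal |f x|}

/-- The non-increasing rearrangement `f*(t) = inf {λ ≥ 0 : f₊(λ) ≤ t}`. -/
def rearr (μ : Measure R) (f : R → ℝ) (t : ℝ≥0∞) : ℝ≥0∞ :=
  sInf {lam : ℝ≥0∞ | distFn μ f lam ≤ t}

/-- The Lorentz functional `‖f‖_{p,q}` for `p, q ∈ (0,∞]`. -/
def lorentzNorm (μ : Measure R) (p q : ℝ≥0∞) (f : R → ℝ) : ℝ≥0∞ :=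
  if q = ⊤ then
    ⨆ t : Set.Ioi (0:ℝ), ENNReal.ofReal t.1 ^ (p⁻¹).toReal * rearr μ f (ENNReal.ofReal t.1)
  else
    (∫⁻ t in Set.Ioi (0:ℝ),
        (ENNReal.ofReal t ^ (p⁻¹).toReal * rearr μ f (ENNReal.ofReal t)) ^ q.toReal
          / ENNReal.ofReal t) ^ (q⁻¹).toReal

/-- The Luxemburg norm `‖f‖_A = inf {λ > 0 : ∫ A(|f|/λ) dμ ≤ 1}`. -/
def luxNorm (μ : Measure R) (A : YoungFunction) (f : R → ℝ) : ℝ≥0∞ :=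
  sInf {lam : ℝ≥0∞ | 0 < lam ∧ ∫⁻ x, A.toFun (ENNReal.ofReal |f x| / lam) ∂μ ≤ 1}

/-- The measure `μ` is non-atomic: every set of positive measure has a subset
of strictly smaller positive measure. -/
def NonAtomic (μ : Measure R) : Prop :=
  ∀ s : Set R, MeasurableSet s → 0 < μ s →
    ∃ t, t ⊆ s ∧ MeasurableSet t ∧ 0 < μ t ∧ μ t < μ s

/-- The almost-compact embedding `X ↪* Y`, for (quasi)norm functionals `NX`, `NY`:
`X ⊂ Y` and for every sequence of measurable sets `Eₙ` whose characteristic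
functions tend to `0` a.e., `sup_{‖f‖_X ≤ 1} ‖f χ_{Eₙ}‖_Y → 0`. -/
def AlmostCompactEmbedding (μ : Measure R) (NX NY : (R → ℝ) → ℝ≥0∞) : Prop :=
  (∀ f : R → ℝ, Measurable f → NX f < ⊤ → NY f < ⊤) ∧
    ∀ E : ℕ → Set R, (∀ n, MeasurableSet (E n)) →
      (∀ᵐ x ∂μ, Filter.Tendsto (fun n => (E n).indicator (fun _ => (1:ℝ)) x)
        Filter.atTop (nhds 0)) →
      Filter.Tendsto
        (fun n => ⨆ f : {f : R → ℝ // Measurable f ∧ NX f ≤ 1},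
          NY ((E n).indicator f.1)) Filter.atTop (nhds 0)

/-- The continuous embedding `X ↪ Y`: there is `C > 0` with `‖f‖_Y ≤ C ‖f‖_X`. -/
def NormEmbedding (μ : Measure R) (NX NY : (R → ℝ) → ℝ≥0∞) : Prop :=
  ∃ C : ℝ, 0 < C ∧ ∀ f : R → ℝ, Measurable f → NY f ≤ ENNReal.ofReal C * NX f

theorem NonAtomic.exists_subset_measure_pos_lt {μ : Measure R} (hna : NonAtomic μ) {E : Set R}
    (hE : MeasurableSet E) (hE0 : 0 < μ E) {ε : ℝ≥0∞} (hε : 0 < ε) :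
    ∃ D ⊆ E, MeasurableSet D ∧ 0 < μ D ∧ μ D < ε := by
  obtain ⟨S, hSE, hS, hS0, hSlt⟩ := hna E hE hE0
  have hSfin : μ S ≠ ⊤ := hSlt.ne_top
  have halving : ∀ n : ℕ, ∃ D ⊆ S, MeasurableSet D ∧ 0 < μ D ∧ μ D ≤ 2⁻¹ ^ n * μ S := by
    intro n
    induction n with
    | zero => exact ⟨S, Subset.rfl, hS, hS0, by simp⟩
    | succ n ih =>
      obtain ⟨D, hDS, hD, hD0, hDle⟩ := ih
      obtain ⟨t, htD, ht, ht0, htlt⟩ := hna D hD hD0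
      have hsplit : μ t + μ (D \ t) = μ D := by
        have h := measure_inter_add_sdiff (μ := μ) D ht
        rwa [inter_eq_self_of_subset_right htD] at h
      have hhalf : ∀ x : ℝ≥0∞, x + x ≤ μ D → x ≤ 2⁻¹ ^ (n + 1) * μ S := by
        intro x hx
        calc x = 2⁻¹ * (x + x) := by
              rw [← two_mul, ← mul_assoc, ENNReal.inv_mul_cancel (by simp) (by simp), one_mul]
          _ ≤ 2⁻¹ * (2⁻¹ ^ n * μ S) := by gcongr; exact hx.trans hDle
          _ = _ := by rw [pow_succ']; ring
      rcases le_total (μ t) (μ (D \ t)) with h | h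
      · refine ⟨t, htD.trans hDS, ht, ht0, hhalf _ ?_⟩
        rw [← hsplit]; gcongr
      · refine ⟨D \ t, sdiff_subset.trans hDS, hD.diff ht, ?_, hhalf _ ?_⟩
        · rw [measure_sdiff htD ht.nullMeasurableSet htlt.ne_top]
          exact tsub_pos_of_lt htlt
        · rw [← hsplit]; gcongr
  obtain ⟨n, hn⟩ := ENNReal.exists_inv_two_pow_lt (ENNReal.div_pos hε.ne' hSfin).ne'
  obtain ⟨D, hDS, hD, hD0, hDle⟩ := halving n
  refine ⟨D, hDS.trans hSE, hD, hD0, hDle.trans_lt ?_⟩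
  rwa [ENNReal.lt_div_iff_mul_lt (Or.inl hS0.ne') (Or.inl hSfin)] at hn

/-- Sierpiński's theorem: a non-atomic measure takes all intermediate values. -/
theorem NonAtomic.exists_subset_measure_eq {μ : Measure R} (hna : NonAtomic μ) {E : Set R}
    (hE : MeasurableSet E) {m : ℝ≥0∞} (hm : m ≤ μ E) :
    ∃ F ⊆ E, MeasurableSet F ∧ μ F = m := by
  rcases eq_or_ne m ⊤ with rfl | hmtop
  · exact ⟨E, Subset.rfl, hE, top_le_iff.1 hm⟩
  have step : ∀ A : Set R, μ A ≤ m → ∃ D ⊆ E \ A, MeasurableSet D ∧ μ A + μ D ≤ m ∧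
      ∀ D' ⊆ E \ A, MeasurableSet D' → μ A + μ D' ≤ m → μ D' ≤ 2 * μ D := by
    intro A hA
    set c : ℝ≥0∞ := ⨆ D : {D : Set R // D ⊆ E \ A ∧ MeasurableSet D ∧ μ A + μ D ≤ m}, μ D.1
      with hc
    have hcle : ∀ D' ⊆ E \ A, MeasurableSet D' → μ A + μ D' ≤ m → μ D' ≤ c := fun D' h1 h2 h3 =>
      le_iSup (fun D : {D : Set R // D ⊆ E \ A ∧ MeasurableSet D ∧ μ A + μ D ≤ m} => μ D.1)
        ⟨D', h1, h2, h3⟩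
    rcases eq_or_ne c 0 with h0 | h0
    · refine ⟨∅, empty_subset _, MeasurableSet.empty, by simpa using hA, fun D' h1 h2 h3 => ?_⟩
      exact (hcle D' h1 h2 h3).trans (by simp [h0])
    · have hctop : c ≠ ⊤ := by
        refine ne_top_of_le_ne_top hmtop (iSup_le fun D => ?_)
        exact le_add_self.trans D.2.2.2
      obtain ⟨D, hD⟩ := lt_iSup_iff.1 (show c / 2 < c from ENNReal.half_lt_self h0 hctop)
      refine ⟨D.1, D.2.1, D.2.2.1, D.2.2.2, fun D' h1 h2 h3 => (hcle D' h1 h2 h3).trans ?_⟩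
      rw [mul_comm]
      exact (ENNReal.div_le_iff (by simp) (by simp)).1 hD.le
  choose! D hDE hDm hDle hDmax using step
  set A : ℕ → Set R := fun n => Nat.rec ∅ (fun _ S => S ∪ D S) n with hAdef
  have hAs : ∀ n, A (n + 1) = A n ∪ D (A n) := fun n => rfl
  have hA : ∀ n, A n ⊆ E ∧ MeasurableSet (A n) ∧ μ (A n) ≤ m := by
    intro n
    induction n with
    | zero => exact ⟨empty_subset _, MeasurableSet.empty, by simp [hAdef]⟩
    | succ n ih =>
      rw [hAs]
      exact ⟨union_subset ih.1 ((hDE _ ih.2.2).trans sdiff_subset), ih.2.1.union (hDm _ ih.2.2),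
        (measure_union_le _ _).trans (hDle _ ih.2.2)⟩
  have hAmono : Monotone A := monotone_nat_of_le_succ fun n => subset_union_left
  have hUm : MeasurableSet (⋃ n, A n) := MeasurableSet.iUnion fun n => (hA n).2.1
  have hUle : μ (⋃ n, A n) ≤ m := by
    rw [hAmono.measure_iUnion]
    exact iSup_le fun n => (hA n).2.2
  refine ⟨⋃ n, A n, iUnion_subset fun n => (hA n).1, hUm, hUle.antisymm ?_⟩
  by_contra! hlt
  have hdiff : 0 < μ (E \ ⋃ n, A n) :=
    (tsub_pos_of_lt (hlt.trans_le hm)).trans_le le_measure_sdiff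
  obtain ⟨S, hSE, hS, hS0, hSlt⟩ :=
    hna.exists_subset_measure_pos_lt (hE.diff hUm) hdiff (tsub_pos_of_lt hlt)
  have hS2 : ∀ n, μ S ≤ 2 * μ (D (A n)) := by
    intro n
    refine hDmax _ (hA n).2.2 S (hSE.trans (sdiff_subset_sdiff_right (subset_iUnion A n))) hS ?_
    calc μ (A n) + μ S ≤ μ (⋃ n, A n) + (m - μ (⋃ n, A n)) := by
          gcongr; exact subset_iUnion A n
      _ = m := add_tsub_cancel_of_le hlt.le
  have hgrow : ∀ n : ℕ, n * μ S ≤ 2 * μ (A n) := by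
    intro n
    induction n with
    | zero => simp
    | succ n ih =>
      rw [hAs, measure_union (disjoint_sdiff_right.mono_right (hDE _ (hA n).2.2))
        (hDm _ (hA n).2.2), mul_add, Nat.cast_succ, add_mul, one_mul]
      exact add_le_add ih (hS2 n)
  have hbound : ∀ n : ℕ, n * μ S ≤ 2 * m := fun n => (hgrow n).trans (by gcongr; exact (hA n).2.2)
  obtain ⟨n, hn⟩ := ENNReal.exists_nat_mul_gt hS0.ne'
    (ENNReal.mul_ne_top (by simp : (2 : ℝ≥0∞) ≠ ⊤) hmtop)
  exact (hn.trans_le (hbound n)).false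

theorem NonAtomic.exists_antitone_measure_eq {μ : Measure R} (hna : NonAtomic μ) {g : ℕ → ℝ≥0∞}
    (hg : Antitone g) (hg0 : g 0 ≤ μ univ) :
    ∃ F : ℕ → Set R, Antitone F ∧ (∀ n, MeasurableSet (F n)) ∧ ∀ n, μ (F n) = g n := by
  have step : ∀ (n : ℕ) (S : {S : Set R // MeasurableSet S ∧ μ S = g n}),
      ∃ T : {S : Set R // MeasurableSet S ∧ μ S = g (n + 1)}, T.1 ⊆ S.1 := by
    rintro n ⟨S, hS, hSn⟩
    obtain ⟨T, hTS, hT, hTn⟩ := hna.exists_subset_measure_eq hS ((hg n.le_succ).trans hSn.ge)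
    exact ⟨⟨T, hT, hTn⟩, hTS⟩
  choose next hnext using step
  obtain ⟨S, -, hS, hS0⟩ := hna.exists_subset_measure_eq MeasurableSet.univ hg0
  let F : (n : ℕ) → {S : Set R // MeasurableSet S ∧ μ S = g n} :=
    fun n => Nat.rec ⟨S, hS, hS0⟩ next n
  exact ⟨fun n => (F n).1, antitone_nat_of_succ_le fun n => hnext n (F n), fun n => (F n).2.1,
    fun n => (F n).2.2⟩

/-- A non-increasing function bounded by the total measure is, up to dilation by `2`, the
distribution function of some measurable function on any prescribed bounded range. -/
theorem NonAtomic.exists_distFn_between {μ : Measure R} (hna : NonAtomic μ) {G : ℝ≥0∞ → ℝ≥0∞}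
    (hG : Antitone G) {a b : ℝ≥0∞} (ha : a ≠ 0) (ha' : a ≠ ⊤) (hb : b ≠ ⊤)
    (hGa : G a ≤ μ univ) :
    ∃ f : R → ℝ, Measurable f ∧ (∀ l, distFn μ f l ≤ G l) ∧
      ∀ l, a ≤ l → l < b → G (2 * l) ≤ distFn μ f l := by
  have hτ : Monotone fun j : ℕ => 2 ^ j * a := fun i j hij => by
    dsimp only
    gcongr
    exact one_le_two
  obtain ⟨F, hF, hFm, hFμ⟩ := hna.exists_antitone_measure_eq (g := fun j => G (2 ^ j * a))
    (fun i j hij => hG (hτ hij)) (by simpa using hGa)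
  obtain ⟨J, hJ⟩ : ∃ J : ℕ, b ≤ 2 ^ J * a := by
    obtain ⟨n, hn⟩ := ENNReal.exists_nat_mul_gt ha hb
    refine ⟨n, hn.le.trans ?_⟩
    gcongr
    exact_mod_cast n.lt_two_pow_self.le
  set g : R → ℝ≥0∞ := fun x => ⨆ j : Fin (J + 1), (F j).indicator (fun _ => 2 ^ (j : ℕ) * a) x
    with hgdef
  have hgm : Measurable g := Measurable.iSup fun j => measurable_const.indicator (hFm j)
  have hgtop : ∀ x, g x ≠ ⊤ := fun x => by
    refine ne_top_of_le_ne_top (b := 2 ^ J * a) (ENNReal.mul_ne_top (by simp) ha') ?_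
    refine iSup_le fun j => (indicator_le_self' (fun _ _ => zero_le) x).trans ?_
    exact hτ (Nat.lt_succ_iff.1 j.2)
  have hmem : ∀ l x, l < g x ↔ ∃ j ≤ J, l < 2 ^ j * a ∧ x ∈ F j := by
    intro l x
    rw [hgdef, lt_iSup_iff]
    constructor
    · rintro ⟨j, hj⟩
      by_cases hx : x ∈ F j
      · exact ⟨j, Nat.lt_succ_iff.1 j.2, by simpa [hx] using hj, hx⟩
      · simp [hx] at hj
    · rintro ⟨j, hjJ, hj, hx⟩
      exact ⟨⟨j, Nat.lt_succ_iff.2 hjJ⟩, by simpa [hx] using hj⟩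
  have hdist : ∀ l, distFn μ (fun x => (g x).toReal) l = μ {x | l < g x} := fun l => by
    simp [distFn, hgtop]
  refine ⟨fun x => (g x).toReal, hgm.ennreal_toReal, fun l => ?_, fun l hal hlb => ?_⟩
  · rw [hdist]
    by_cases hex : ∃ j : ℕ, l < 2 ^ j * a
    · classical
      calc μ {x | l < g x} ≤ μ (F (Nat.find hex)) := by
            refine measure_mono fun x hx => ?_
            obtain ⟨j, -, hj, hxj⟩ := (hmem l x).1 hx
            exact hF (Nat.find_min' hex hj) hxj
        _ ≤ G l := by rw [hFμ]; exact hG (Nat.find_spec hex).le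
    · have : {x | l < g x} = ∅ := by
        refine eq_empty_of_forall_notMem fun x hx => ?_
        obtain ⟨j, -, hj, -⟩ := (hmem l x).1 hx
        exact hex ⟨j, hj⟩
      simp [this]
  · classical
    have hex : ∃ j : ℕ, l < 2 ^ j * a := ⟨J, hlb.trans_le hJ⟩
    obtain ⟨k, hk⟩ : ∃ k, Nat.find hex = k + 1 := by
      refine Nat.exists_eq_succ_of_ne_zero fun h0 => ?_
      have := Nat.find_spec hex
      rw [h0, pow_zero, one_mul] at this
      exact this.not_ge hal
    have hkl : 2 ^ k * a ≤ l := not_lt.1 (Nat.find_min hex (by omega : k < Nat.find hex))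
    rw [hdist]
    calc G (2 * l) ≤ G (2 ^ (k + 1) * a) := by
          refine hG ?_
          rw [pow_succ', mul_assoc]
          gcongr
      _ = μ (F (k + 1)) := (hFμ _).symm
      _ ≤ μ {x | l < g x} := measure_mono fun x hx => (hmem l x).2
          ⟨k + 1, hk ▸ Nat.find_min' hex (hlb.trans_le hJ), hk ▸ Nat.find_spec hex, hx⟩

theorem ENNReal.setLIntegral_Ioo_rpow_div {q : ℝ} (hq : 0 < q) {a : ℝ} (ha : 0 ≤ a) :
    ∫⁻ t in Ioo (0 : ℝ) a, ENNReal.ofReal t ^ q / ENNReal.ofReal t =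
      ENNReal.ofReal a ^ q / ENNReal.ofReal q := by
  have hint : IntervalIntegrable (fun t : ℝ => t ^ (q - 1)) volume 0 a :=
    intervalIntegral.intervalIntegrable_rpow' (by linarith)
  have hval : ∫ t in (0 : ℝ)..a, t ^ (q - 1) = a ^ q / q := by
    rw [integral_rpow (Or.inl (by linarith)), sub_add_cancel, Real.zero_rpow hq.ne', sub_zero]
  calc ∫⁻ t in Ioo (0 : ℝ) a, ENNReal.ofReal t ^ q / ENNReal.ofReal t
      = ∫⁻ t in Ioo (0 : ℝ) a, ENNReal.ofReal (t ^ (q - 1)) := by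
        refine setLIntegral_congr_fun measurableSet_Ioo fun t ht => ?_
        rw [ENNReal.ofReal_rpow_of_pos ht.1, ← ENNReal.ofReal_div_of_pos ht.1,
          Real.rpow_sub_one ht.1.ne']
    _ = ∫⁻ t in Ioc (0 : ℝ) a, ENNReal.ofReal (t ^ (q - 1)) :=
        setLIntegral_congr Ioo_ae_eq_Ioc
    _ = ENNReal.ofReal (∫ t in Ioc (0 : ℝ) a, t ^ (q - 1)) := by
        refine (ofReal_integral_eq_lintegral_ofReal
          ((intervalIntegrable_iff_integrableOn_Ioc_of_le ha).1 hint) ?_).symm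
        filter_upwards [ae_restrict_mem measurableSet_Ioc] with t ht
        exact Real.rpow_nonneg ht.1.le _
    _ = _ := by
        rw [← intervalIntegral.integral_of_le ha, hval, ENNReal.ofReal_div_of_pos hq,
          ENNReal.ofReal_rpow_of_nonneg ha hq.le]

theorem ENNReal.lintegral_ite_lt_rpow_div {q : ℝ} (hq : 0 < q) (a : ℝ≥0∞) :
    ∫⁻ t in Ioi (0 : ℝ), (if ENNReal.ofReal t < a then
      ENNReal.ofReal t ^ q / ENNReal.ofReal t else 0) = a ^ q / ENNReal.ofReal q := by
  have hfin : ∀ b : ℝ, 0 ≤ b → ∫⁻ t in Ioi (0 : ℝ), (if ENNReal.ofReal t < ENNReal.ofReal b then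
      ENNReal.ofReal t ^ q / ENNReal.ofReal t else 0) =
        ENNReal.ofReal b ^ q / ENNReal.ofReal q := by
    intro b hb
    rw [← ENNReal.setLIntegral_Ioo_rpow_div hq hb, ← Ioi_inter_Iio,
      ← Measure.restrict_restrict_of_subset (s := Ioi 0 ∩ Iio b) inter_subset_left,
      ← lintegral_indicator (measurableSet_Ioi.inter measurableSet_Iio)]
    refine setLIntegral_congr_fun measurableSet_Ioi fun t ht => ?_
    by_cases htb : t < b
    · simp [indicator, htb, ENNReal.ofReal_lt_ofReal_iff_of_nonneg (le_of_lt ht), mem_Ioi.1 ht]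
    · simp [indicator, htb, ENNReal.ofReal_lt_ofReal_iff_of_nonneg (le_of_lt ht)]
  rcases eq_or_ne a ⊤ with rfl | ha
  · rw [ENNReal.top_rpow_of_pos hq, ENNReal.top_div_of_ne_top ENNReal.ofReal_ne_top]
    refine ENNReal.eq_top_of_forall_nnreal_le fun M => ?_
    have hb : 0 ≤ (M * q) ^ q⁻¹ := by positivity
    calc (M : ℝ≥0∞) = ENNReal.ofReal ((M * q) ^ q⁻¹) ^ q / ENNReal.ofReal q := by
          rw [ENNReal.ofReal_rpow_of_nonneg hb hq.le, ← ENNReal.ofReal_div_of_pos hq,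
            ← Real.rpow_mul (by positivity), inv_mul_cancel₀ hq.ne', Real.rpow_one,
            mul_div_cancel_right₀ _ hq.ne', ENNReal.ofReal_coe_nnreal]
      _ ≤ _ := by
          rw [← hfin _ hb]
          refine lintegral_mono fun t => ?_
          split_ifs <;> simp_all
  · have := hfin a.toReal ENNReal.toReal_nonneg
    rwa [ENNReal.ofReal_toReal ha] at this

theorem distFn_antitone (μ : Measure R) (f : R → ℝ) : Antitone (distFn μ f) :=
  fun _ _ h => measure_mono fun _ hx => lt_of_le_of_lt h hx

theorem measurable_distFn (μ : Measure R) (f : R → ℝ) : Measurable (distFn μ f) :=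
  (distFn_antitone μ f).measurable

theorem lt_rearr_iff (μ : Measure R) (f : R → ℝ) (l t : ℝ≥0∞) :
    l < rearr μ f t ↔ t < distFn μ f l := by
  constructor
  · intro h
    by_contra! h'
    exact (h.trans_le (sInf_le h')).false
  · intro h
    have hl : l < ⊤ := by
      refine lt_top_iff_ne_top.2 fun hl => ?_
      simp [hl, distFn] at h
    obtain ⟨u, hu, hul, hulim⟩ := exists_seq_strictAnti_tendsto' hl
    have hmono : Monotone fun n => {x | u n < ENNReal.ofReal |f x|} :=
      fun m n hmn x hx => (hu.antitone hmn).trans_lt hx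
    have hunion : {x | l < ENNReal.ofReal |f x|} = ⋃ n, {x | u n < ENNReal.ofReal |f x|} := by
      ext x
      simp only [mem_ofPred_eq, mem_iUnion]
      exact ⟨fun hx => (hulim.eventually_lt_const hx).exists,
        fun ⟨n, hn⟩ => (hul n).1.trans hn⟩
    rw [distFn, hunion, hmono.measure_iUnion, lt_iSup_iff] at h
    obtain ⟨n, hn⟩ := h
    refine (hul n).1.trans_le (le_sInf fun m hm => ?_)
    by_contra! hmu
    exact (hn.trans_le ((distFn_antitone μ f hmu.le).trans hm)).false

theorem rearr_antitone (μ : Measure R) (f : R → ℝ) : Antitone (rearr μ f) :=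
  fun _ _ h => sInf_le_sInf fun _ hl => le_trans hl h

/-- The Lorentz integral expressed through the distribution function. -/
theorem lintegral_rearr_eq_lintegral_distFn (μ : Measure R) (f : R → ℝ) {r q : ℝ} (hr : 0 < r)
    (hq : 0 < q) :
    ∫⁻ t in Ioi (0 : ℝ), (ENNReal.ofReal t ^ r⁻¹ * rearr μ f (ENNReal.ofReal t)) ^ q
        / ENNReal.ofReal t =
      ENNReal.ofReal r * ∫⁻ l in Ioi (0 : ℝ), ENNReal.ofReal l ^ q *
        distFn μ f (ENNReal.ofReal l) ^ (q / r) / ENNReal.ofReal l := by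
  have hqr : 0 < q / r := div_pos hq hr
  have hDm : Measurable fun l : ℝ => distFn μ f (ENNReal.ofReal l) :=
    (measurable_distFn μ f).comp ENNReal.measurable_ofReal
  have hq0 : ENNReal.ofReal q ≠ 0 := by simpa using hq
  calc _ = ∫⁻ t in Ioi (0 : ℝ), ∫⁻ l in Ioi (0 : ℝ),
        (if ENNReal.ofReal t < distFn μ f (ENNReal.ofReal l) then
          ENNReal.ofReal q * (ENNReal.ofReal t ^ (q / r) / ENNReal.ofReal t) *
            (ENNReal.ofReal l ^ q / ENNReal.ofReal l) else 0) := by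
        refine lintegral_congr fun t => ?_
        have key := ENNReal.lintegral_ite_lt_rpow_div hq (rearr μ f (ENNReal.ofReal t))
        calc _ = ENNReal.ofReal q * (ENNReal.ofReal t ^ (q / r) / ENNReal.ofReal t) *
              (rearr μ f (ENNReal.ofReal t) ^ q / ENNReal.ofReal q) := by
              rw [ENNReal.mul_rpow_of_nonneg _ _ hq.le, ← ENNReal.rpow_mul, inv_mul_eq_div]
              simp only [div_eq_mul_inv]
              calc _ = ENNReal.ofReal q * (ENNReal.ofReal q)⁻¹ * (ENNReal.ofReal t ^ (q * r⁻¹) *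
                    rearr μ f (ENNReal.ofReal t) ^ q * (ENNReal.ofReal t)⁻¹) := by
                    rw [ENNReal.mul_inv_cancel hq0 ENNReal.ofReal_ne_top, one_mul]
                _ = _ := by ring
          _ = _ := by
              rw [← key, ← lintegral_const_mul _ (by
                refine Measurable.ite (measurableSet_lt ENNReal.measurable_ofReal
                  measurable_const) (by fun_prop) measurable_const)]
              refine lintegral_congr fun l => ?_
              simp only [lt_rearr_iff, mul_ite, mul_zero]
    _ = ∫⁻ l in Ioi (0 : ℝ), ∫⁻ t in Ioi (0 : ℝ),
        (if ENNReal.ofReal t < distFn μ f (ENNReal.ofReal l) then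
          ENNReal.ofReal q * (ENNReal.ofReal t ^ (q / r) / ENNReal.ofReal t) *
            (ENNReal.ofReal l ^ q / ENNReal.ofReal l) else 0) := by
        refine lintegral_lintegral_swap (Measurable.aemeasurable ?_)
        refine Measurable.ite (measurableSet_lt (by fun_prop) (hDm.comp measurable_snd))
          (by fun_prop) measurable_const
    _ = ∫⁻ l in Ioi (0 : ℝ), ENNReal.ofReal r * (ENNReal.ofReal l ^ q *
        distFn μ f (ENNReal.ofReal l) ^ (q / r) / ENNReal.ofReal l) := by
        refine lintegral_congr fun l => ?_
        have key := ENNReal.lintegral_ite_lt_rpow_div hqr (distFn μ f (ENNReal.ofReal l))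
        calc _ = ENNReal.ofReal q * (ENNReal.ofReal l ^ q / ENNReal.ofReal l) *
              (distFn μ f (ENNReal.ofReal l) ^ (q / r) / ENNReal.ofReal (q / r)) := by
              rw [← key, ← lintegral_const_mul _ (by
                refine Measurable.ite (measurableSet_lt ENNReal.measurable_ofReal
                  measurable_const) (by fun_prop) measurable_const)]
              refine lintegral_congr fun t => ?_
              split_ifs
              · ring
              · simp
          _ = _ := by
              have : ENNReal.ofReal q / ENNReal.ofReal (q / r) = ENNReal.ofReal r := by
                rw [← ENNReal.ofReal_div_of_pos hqr, div_div_cancel₀ hq.ne']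
              rw [← this]
              simp only [div_eq_mul_inv]
              ring
    _ = _ := lintegral_const_mul _ (by fun_prop)

namespace YoungFunction

theorem measurable (B : YoungFunction) : Measurable B.toFun := B.mono.measurable

theorem map_mul_le (B : YoungFunction) {c : ℝ≥0∞} (hc : c ≤ 1) (t : ℝ≥0∞) :
    B.toFun (c * t) ≤ c * B.toFun t := by
  simpa [B.map_zero] using B.convex' t 0 c hc

theorem div_le_div (B : YoungFunction) {l m : ℝ≥0∞} (hl : l ≠ 0) (hlm : l ≤ m) (hm : m ≠ ⊤) :
    B.toFun l / l ≤ B.toFun m / m := by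
  have hm0 : m ≠ 0 := (hl.bot_lt.trans_le hlm).ne'
  refine ENNReal.div_le_of_le_mul ?_
  calc B.toFun l = B.toFun (l / m * m) := by rw [ENNReal.div_mul_cancel hm0 hm]
    _ ≤ l / m * B.toFun m := B.map_mul_le (ENNReal.div_le_of_le_mul (by rwa [one_mul])) m
    _ = B.toFun m / m * l := by simp only [div_eq_mul_inv]; ring

theorem lintegral_div_le (B : YoungFunction) {y : ℝ≥0∞} (hy : y ≠ ⊤) :
    ∫⁻ t in Ioi (0 : ℝ), (if ENNReal.ofReal t < y then
      B.toFun (ENNReal.ofReal t) / ENNReal.ofReal t else 0) ≤ B.toFun y := by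
  rcases eq_or_ne y 0 with rfl | hy0
  · simp
  calc _ ≤ ∫⁻ t in Ioi (0 : ℝ), (Iio y.toReal).indicator (fun _ => B.toFun y / y) t := by
        refine setLIntegral_mono' measurableSet_Ioi fun t ht => ?_
        split_ifs with h
        · rw [indicator_of_mem (show t ∈ Iio y.toReal from
            (ENNReal.ofReal_lt_iff_lt_toReal (le_of_lt ht) hy).1 h)]
          exact B.div_le_div (by simpa using ht) h.le hy
        · exact zero_le
    _ = B.toFun y / y * ENNReal.ofReal y.toReal := by
        rw [lintegral_indicator_const measurableSet_Iio,
          Measure.restrict_apply measurableSet_Iio, Iio_inter_Ioi, Real.volume_Ioo, sub_zero]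
    _ = B.toFun y := by
        rw [ENNReal.ofReal_toReal hy, ENNReal.div_mul_cancel hy0 hy]

theorem map_half_le_lintegral_div (B : YoungFunction) {y : ℝ≥0∞} (hy : y ≠ ⊤) :
    B.toFun (y / 2) ≤ ∫⁻ t in Ioi (0 : ℝ), (if ENNReal.ofReal t < y then
      B.toFun (ENNReal.ofReal t) / ENNReal.ofReal t else 0) := by
  rcases eq_or_ne y 0 with rfl | hy0
  · simp [B.map_zero]
  have hh0 : y / 2 ≠ 0 := by simpa using hy0
  have hhtop : y / 2 ≠ ⊤ := ENNReal.div_ne_top hy (by simp)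
  have hY : 0 < y.toReal := ENNReal.toReal_pos hy0 hy
  have hyY : y / 2 = ENNReal.ofReal (y.toReal / 2) := by
    rw [ENNReal.ofReal_div_of_pos two_pos, ENNReal.ofReal_toReal hy, ENNReal.ofReal_ofNat]
  calc B.toFun (y / 2) = B.toFun (y / 2) / (y / 2) * (y / 2) := by
        rw [ENNReal.div_mul_cancel hh0 hhtop]
    _ = ∫⁻ t in Ioi (0 : ℝ),
        (Ioo (y.toReal / 2) y.toReal).indicator (fun _ => B.toFun (y / 2) / (y / 2)) t := by
        rw [lintegral_indicator_const measurableSet_Ioo,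
          Measure.restrict_apply measurableSet_Ioo, inter_eq_self_of_subset_left, Real.volume_Ioo,
          _root_.sub_half, ← hyY]
        exact fun t ht => (half_pos hY).trans ht.1
    _ ≤ _ := by
        refine setLIntegral_mono' measurableSet_Ioi fun t ht => ?_
        by_cases h : t ∈ Ioo (y.toReal / 2) y.toReal
        · rw [indicator_of_mem h,
            if_pos ((ENNReal.ofReal_lt_iff_lt_toReal (le_of_lt ht) hy).2 h.2)]
          refine B.div_le_div hh0 ?_ ENNReal.ofReal_ne_top
          rw [hyY]
          exact ENNReal.ofReal_le_ofReal h.1.le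
        · rw [indicator_of_notMem h]
          exact zero_le

end YoungFunction

/-- Layer-cake formula for an `ℝ≥0∞`-valued density. -/
theorem lintegral_lintegral_ite_lt_eq_lintegral_mul_distFn (μ : Measure R) [SFinite μ] {f : R → ℝ}
    (hf : Measurable f) {φ : ℝ → ℝ≥0∞} (hφ : Measurable φ) :
    ∫⁻ x, (∫⁻ t in Ioi (0 : ℝ), if ENNReal.ofReal t < ENNReal.ofReal |f x| then φ t else 0) ∂μ =
      ∫⁻ t in Ioi (0 : ℝ), φ t * distFn μ f (ENNReal.ofReal t) := by
  have hf' : Measurable fun x => ENNReal.ofReal |f x| := by fun_prop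
  rw [lintegral_lintegral_swap (Measurable.aemeasurable (by
    exact Measurable.ite (measurableSet_lt (by fun_prop) (hf'.comp measurable_fst))
      (hφ.comp measurable_snd) measurable_const))]
  refine lintegral_congr fun t => ?_
  calc _ = ∫⁻ x, {x | ENNReal.ofReal t < ENNReal.ofReal |f x|}.indicator (fun _ => φ t) x ∂μ := by
        refine lintegral_congr fun x => ?_
        simp [indicator]
    _ = _ := lintegral_indicator_const (measurableSet_lt measurable_const hf') _

theorem lintegral_mul_distFn_le (μ : Measure R) [SFinite μ] (B : YoungFunction) {f : R → ℝ}
    (hf : Measurable f) :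
    ∫⁻ t in Ioi (0 : ℝ), B.toFun (ENNReal.ofReal t) / ENNReal.ofReal t *
      distFn μ f (ENNReal.ofReal t) ≤ ∫⁻ x, B.toFun (ENNReal.ofReal |f x|) ∂μ := by
  have := B.measurable
  rw [← lintegral_lintegral_ite_lt_eq_lintegral_mul_distFn μ hf (by fun_prop)]
  exact lintegral_mono fun x => B.lintegral_div_le ENNReal.ofReal_ne_top

theorem lintegral_half_le_lintegral_mul_distFn (μ : Measure R) [SFinite μ] (B : YoungFunction)
    {f : R → ℝ} (hf : Measurable f) :
    ∫⁻ x, B.toFun (ENNReal.ofReal |f x| / 2) ∂μ ≤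
      ∫⁻ t in Ioi (0 : ℝ), B.toFun (ENNReal.ofReal t) / ENNReal.ofReal t *
        distFn μ f (ENNReal.ofReal t) := by
  have := B.measurable
  rw [← lintegral_lintegral_ite_lt_eq_lintegral_mul_distFn μ hf (by fun_prop)]
  exact lintegral_mono fun x => B.map_half_le_lintegral_div ENNReal.ofReal_ne_top

theorem lintegral_le_one_of_luxNorm_lt_one {μ : Measure R} {B : YoungFunction} {f : R → ℝ}
    (h : luxNorm μ B f < 1) : ∫⁻ x, B.toFun (ENNReal.ofReal |f x|) ∂μ ≤ 1 := by
  obtain ⟨l, ⟨hl0, hl⟩, hl1⟩ := sInf_lt_iff.1 h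
  refine (lintegral_mono fun x => B.mono ?_).trans hl
  rw [ENNReal.le_div_iff_mul_le (Or.inl hl0.ne') (Or.inl hl1.ne_top)]
  exact mul_le_of_le_one_right' hl1.le

theorem rearr_const_mul_le (μ : Measure R) (f : R → ℝ) {c : ℝ} (hc : 0 < c) (t : ℝ≥0∞) :
    rearr μ (fun x => c * f x) t ≤ ENNReal.ofReal c * rearr μ f t := by
  have hc0 : ENNReal.ofReal c ≠ 0 := by simpa using hc
  rw [← ENNReal.div_le_iff' hc0 ENNReal.ofReal_ne_top]
  refine le_sInf fun l hl => ?_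
  rw [ENNReal.div_le_iff' hc0 ENNReal.ofReal_ne_top]
  refine sInf_le (le_trans (measure_mono fun x hx => ?_) hl)
  simp only [mem_ofPred_eq, abs_mul, abs_of_pos hc, ENNReal.ofReal_mul hc.le] at hx
  exact lt_of_mul_lt_mul_left' hx

theorem lorentzNorm_const_mul_le (μ : Measure R) (p : ℝ≥0∞) {q : ℝ≥0∞} (hq : q ≠ 0) (f : R → ℝ)
    {c : ℝ} (hc : 0 < c) :
    lorentzNorm μ p q (fun x => c * f x) ≤ ENNReal.ofReal c * lorentzNorm μ p q f := by
  rw [lorentzNorm, lorentzNorm]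
  split_ifs with hqt
  · rw [ENNReal.mul_iSup]
    refine iSup_mono fun t => ?_
    calc _ ≤ ENNReal.ofReal t.1 ^ (p⁻¹).toReal *
          (ENNReal.ofReal c * rearr μ f (ENNReal.ofReal t.1)) := by
          gcongr
          exact rearr_const_mul_le μ f hc _
      _ = _ := by ring
  · have hq' : 0 < q.toReal := ENNReal.toReal_pos hq hqt
    have hm : Measurable fun t : ℝ => rearr μ f (ENNReal.ofReal t) :=
      (rearr_antitone μ f).measurable.comp ENNReal.measurable_ofReal
    calc _ ≤ (∫⁻ t in Ioi (0 : ℝ), ENNReal.ofReal c ^ q.toReal * ((ENNReal.ofReal t ^ (p⁻¹).toReal *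
          rearr μ f (ENNReal.ofReal t)) ^ q.toReal / ENNReal.ofReal t)) ^ (q⁻¹).toReal := by
          gcongr with t
          rw [← mul_div_assoc, ← ENNReal.mul_rpow_of_nonneg _ _ hq'.le, mul_left_comm]
          gcongr
          exact rearr_const_mul_le μ f hc _
      _ = _ := by
          rw [lintegral_const_mul _ (by fun_prop),
            ENNReal.mul_rpow_of_nonneg _ _ ENNReal.toReal_nonneg, ← ENNReal.rpow_mul,
            ENNReal.toReal_inv, mul_inv_cancel₀ hq'.ne', ENNReal.rpow_one]

/-- A modular bound on the unit ball gives the norm embedding. -/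
theorem normEmbedding_of_lintegral_le {μ : Measure R} {B : YoungFunction} {p q : ℝ≥0∞}
    (hq : q ≠ 0) {K : ℝ≥0∞} (hK : K ≠ ⊤)
    (h : ∀ f : R → ℝ, Measurable f → lorentzNorm μ p q f ≤ 1 →
      ∫⁻ x, B.toFun (ENNReal.ofReal |f x| / 2) ∂μ ≤ K) :
    NormEmbedding μ (lorentzNorm μ p q) (luxNorm μ B) := by
  set M : ℝ≥0∞ := max 1 K with hMdef
  have hM0 : M ≠ 0 := (zero_lt_one.trans_le (le_max_left 1 K)).ne'
  have hMt : M ≠ ⊤ := max_ne_top one_ne_top hK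
  have hC : ENNReal.ofReal (2 * M.toReal) = 2 * M := by
    rw [ENNReal.ofReal_mul two_pos.le, ENNReal.ofReal_toReal hMt, ENNReal.ofReal_ofNat]
  have hC0 : 2 * M ≠ 0 := mul_ne_zero two_ne_zero hM0
  have hCt : 2 * M ≠ ⊤ := ENNReal.mul_ne_top (by simp) hMt
  refine ⟨2 * M.toReal, mul_pos two_pos (ENNReal.toReal_pos hM0 hMt), fun f hf => ?_⟩
  rw [hC, ← ENNReal.div_le_iff' hC0 hCt]
  refine le_of_forall_gt_imp_ge_of_dense fun n hn => ?_
  rw [ENNReal.div_le_iff' hC0 hCt]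
  rcases eq_or_ne n ⊤ with rfl | hnt
  · rw [ENNReal.mul_top hC0]
    exact le_top
  have hn0 : n ≠ 0 := (zero_le.trans_lt hn).ne'
  have hn' : 0 < n.toReal := ENNReal.toReal_pos hn0 hnt
  have hng : ENNReal.ofReal (n.toReal)⁻¹ = n⁻¹ := by
    rw [ENNReal.ofReal_inv_of_pos hn', ENNReal.ofReal_toReal hnt]
  have hg := h (fun x => (n.toReal)⁻¹ * f x) (by fun_prop) (by
    refine (lorentzNorm_const_mul_le μ p hq f (inv_pos.2 hn')).trans ?_
    rw [hng, mul_comm, ← div_eq_mul_inv]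
    exact ENNReal.div_le_of_le_mul (by simpa using hn.le))
  refine sInf_le ⟨(mul_ne_zero hC0 hn0).bot_lt, ?_⟩
  have hMinv : M⁻¹ ≤ 1 := ENNReal.inv_le_one.2 (le_max_left 1 K)
  calc ∫⁻ x, B.toFun (ENNReal.ofReal |f x| / (2 * M * n)) ∂μ
      ≤ ∫⁻ x, M⁻¹ * B.toFun (ENNReal.ofReal |(n.toReal)⁻¹ * f x| / 2) ∂μ := by
        refine lintegral_mono fun x => (le_of_eq ?_).trans (B.map_mul_le hMinv _)
        congr 1
        rw [abs_mul, abs_of_pos (inv_pos.2 hn'), ENNReal.ofReal_mul (inv_pos.2 hn').le, hng]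
        simp only [div_eq_mul_inv]
        rw [ENNReal.mul_inv (Or.inl hC0) (Or.inl hCt),
          ENNReal.mul_inv (Or.inl two_ne_zero) (Or.inl (by simp))]
        ring
    _ = M⁻¹ * ∫⁻ x, B.toFun (ENNReal.ofReal |(n.toReal)⁻¹ * f x| / 2) ∂μ :=
        lintegral_const_mul' _ _ (ENNReal.inv_ne_top.2 hM0)
    _ ≤ M⁻¹ * M := by
        gcongr
        exact hg.trans (le_max_right 1 K)
    _ = 1 := ENNReal.inv_mul_cancel hM0 hMt

theorem lorentzNorm_rpow (μ : Measure R) (f : R → ℝ) {r : ℝ} (hr : 0 < r) {s : ℝ≥0∞}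
    (hs : s ≠ 0) (hs' : s ≠ ⊤) :
    lorentzNorm μ (ENNReal.ofReal r) s f ^ s.toReal =
      ENNReal.ofReal r * ∫⁻ l in Ioi (0 : ℝ), ENNReal.ofReal l ^ s.toReal *
        distFn μ f (ENNReal.ofReal l) ^ (s.toReal / r) / ENNReal.ofReal l := by
  have hsr : 0 < s.toReal := ENNReal.toReal_pos hs hs'
  rw [← lintegral_rearr_eq_lintegral_distFn μ f hr hsr, lorentzNorm, if_neg hs',
    ← ENNReal.rpow_mul, ENNReal.toReal_inv, ENNReal.toReal_inv, ENNReal.toReal_ofReal hr.le,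
    inv_mul_cancel₀ hsr.ne', ENNReal.rpow_one]

theorem lorentzNorm_top_le_iff (μ : Measure R) (f : R → ℝ) {r : ℝ} (hr : 0 < r) {k : ℝ≥0∞}
    (hk : k ≠ 0) (hk' : k ≠ ⊤) :
    lorentzNorm μ (ENNReal.ofReal r) ⊤ f ≤ k ↔
      ∀ l : ℝ, 0 < l → distFn μ f (ENNReal.ofReal l) ≤ (k / ENNReal.ofReal l) ^ r := by
  rw [lorentzNorm, if_pos rfl, ENNReal.toReal_inv, ENNReal.toReal_ofReal hr.le, iSup_le_iff]
  have swap : ∀ t l : ℝ, 0 < t → 0 < l → (ENNReal.ofReal t ≤ (k / ENNReal.ofReal l) ^ r ↔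
      ENNReal.ofReal l ≤ k / ENNReal.ofReal t ^ r⁻¹) := by
    intro t l ht hl
    have ht0 : ENNReal.ofReal t ≠ 0 := by simpa using ht
    have hl0 : ENNReal.ofReal l ≠ 0 := by simpa using hl
    have ht1 : ENNReal.ofReal t ^ r⁻¹ ≠ 0 := by simp [ht0]
    have ht2 : ENNReal.ofReal t ^ r⁻¹ ≠ ⊤ :=
      ENNReal.rpow_ne_top_of_nonneg (inv_pos.2 hr).le ENNReal.ofReal_ne_top
    rw [← ENNReal.rpow_inv_le_iff hr, ENNReal.le_div_iff_mul_le (Or.inl hl0) (Or.inl (by simp)),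
      ENNReal.le_div_iff_mul_le (Or.inl ht1) (Or.inl ht2), mul_comm]
  constructor
  · intro h l hl
    by_contra! hlt
    obtain ⟨t', ht1, ht2⟩ := exists_between hlt
    have htt : t' ≠ ⊤ := ht2.ne_top
    have ht0 : 0 < t'.toReal := ENNReal.toReal_pos (zero_le.trans_lt ht1).ne' htt
    rw [← ENNReal.ofReal_toReal htt] at ht1 ht2
    have ht3 : ENNReal.ofReal t'.toReal ^ r⁻¹ ≠ 0 := by simp [ht0]
    have ht4 : ENNReal.ofReal t'.toReal ^ r⁻¹ ≠ ⊤ :=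
      ENNReal.rpow_ne_top_of_nonneg (inv_pos.2 hr).le ENNReal.ofReal_ne_top
    refine ht1.not_ge ((swap _ _ ht0 hl).2 (((lt_rearr_iff μ f _ _).2 ht2).le.trans ?_))
    rw [ENNReal.le_div_iff_mul_le (Or.inl ht3) (Or.inl ht4), mul_comm]
    exact h ⟨_, ht0⟩
  · rintro h ⟨t, ht⟩
    have ht : 0 < t := ht
    have ht0 : ENNReal.ofReal t ≠ 0 := by simpa using ht
    have ht3 : ENNReal.ofReal t ^ r⁻¹ ≠ 0 := by simp [ht0]
    have ht4 : ENNReal.ofReal t ^ r⁻¹ ≠ ⊤ :=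
      ENNReal.rpow_ne_top_of_nonneg (inv_pos.2 hr).le ENNReal.ofReal_ne_top
    have hvt : k / ENNReal.ofReal t ^ r⁻¹ ≠ ⊤ := ENNReal.div_ne_top hk' ht3
    have hv0 : 0 < (k / ENNReal.ofReal t ^ r⁻¹).toReal :=
      ENNReal.toReal_pos (ENNReal.div_pos hk ht4).ne' hvt
    dsimp only
    rw [mul_comm, ← ENNReal.le_div_iff_mul_le (Or.inl ht3) (Or.inl ht4),
      ← ENNReal.ofReal_toReal hvt]
    by_contra! hlt
    rw [lt_rearr_iff] at hlt
    have h1 := (swap t (k / ENNReal.ofReal t ^ r⁻¹).toReal ht hv0).not.1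
      (fun h2 => ?_)
    · exact h1 (ENNReal.ofReal_toReal hvt).le
    · refine (hlt.trans_le (h _ hv0)).not_ge ?_
      rw [ENNReal.ofReal_toReal hvt, ENNReal.div_div_cancel hk hk', ← ENNReal.rpow_mul,
        inv_mul_cancel₀ hr.ne', ENNReal.rpow_one]

/-- Hölder's inequality with respect to the measure `dx / w`. -/
theorem ENNReal.lintegral_mul_div_le_Lp_mul_Lq {α : Type*} [MeasurableSpace α] (ν : Measure α)
    {p q : ℝ} (hpq : p.HolderConjugate q) {f g w : α → ℝ≥0∞} (hf : Measurable f)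
    (hg : Measurable g) (hw : Measurable w) (hw0 : ∀ᵐ x ∂ν, w x ≠ 0) (hw1 : ∀ x, w x ≠ ⊤) :
    ∫⁻ x, f x * g x / w x ∂ν ≤
      (∫⁻ x, f x ^ p / w x ∂ν) ^ (1 / p) * (∫⁻ x, g x ^ q / w x ∂ν) ^ (1 / q) := by
  have hpow : ∀ (h : α → ℝ≥0∞) (c : ℝ), 0 < c → ∀ x,
      (h x / w x ^ (1 / c)) ^ c = h x ^ c / w x := fun h c hc x => by
    rw [ENNReal.div_rpow_of_nonneg _ _ hc.le, ← ENNReal.rpow_mul, one_div_mul_cancel hc.ne',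
      ENNReal.rpow_one]
  have := ENNReal.lintegral_mul_le_Lp_mul_Lq ν hpq
    (f := fun x => f x / w x ^ (1 / p)) (g := fun x => g x / w x ^ (1 / q))
    (by fun_prop) (by fun_prop)
  simp only [hpow f p hpq.pos, hpow g q hpq.symm.pos] at this
  refine le_trans (le_of_eq (lintegral_congr_ae ?_)) this
  filter_upwards [hw0] with x hx
  have hwx : w x ^ (1 / p) * w x ^ (1 / q) = w x := by
    rw [← ENNReal.rpow_add _ _ hx (hw1 x), one_div, one_div, hpq.inv_add_inv_eq_one,
      ENNReal.rpow_one]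
  have hp0 : w x ^ (1 / p) ≠ 0 := by simp [hx, hw1 x]
  have hpt : w x ^ (1 / p) ≠ ⊤ := by simp [hx, hw1 x]
  simp only [Pi.mul_apply, div_eq_mul_inv (f x), div_eq_mul_inv (g x), div_eq_mul_inv (f x * g x)]
  conv_lhs => rw [← hwx]
  rw [ENNReal.mul_inv (Or.inl hp0) (Or.inl hpt)]
  ring

theorem YoungFunction.ne_top_of_lintegral_lt_top (B : YoungFunction) {r p a : ℝ} (hr : 0 ≤ r)
    (hp : 0 < p)
    (h : ∫⁻ t in Ioi a, (B.toFun (ENNReal.ofReal t) / ENNReal.ofReal t ^ r) ^ p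
      / ENNReal.ofReal t < ⊤) (x : ℝ) : B.toFun (ENNReal.ofReal x) ≠ ⊤ := by
  intro hx
  refine h.ne (top_le_iff.1 ?_)
  calc (⊤ : ℝ≥0∞) = ∫⁻ _ in Ioi (max a x), ⊤ := by simp
    _ ≤ ∫⁻ t in Ioi (max a x), (B.toFun (ENNReal.ofReal t) / ENNReal.ofReal t ^ r) ^ p
          / ENNReal.ofReal t := by
        refine setLIntegral_mono' measurableSet_Ioi fun t ht => ?_
        have hB : B.toFun (ENNReal.ofReal t) = ⊤ := top_le_iff.1
          (hx.ge.trans (B.mono (ENNReal.ofReal_le_ofReal ((le_max_right a x).trans (le_of_lt ht)))))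
        rw [hB, ENNReal.top_div_of_ne_top (ENNReal.rpow_ne_top_of_nonneg hr ENNReal.ofReal_ne_top),
          ENNReal.top_rpow_of_pos hp, ENNReal.top_div_of_ne_top ENNReal.ofReal_ne_top]
    _ ≤ _ := lintegral_mono_set (Ioi_subset_Ioi (le_max_left a x))

theorem ENNReal.div_mul_eq_div_rpow_mul_div {x : ℝ≥0∞} (hx : x ≠ 0) (hx' : x ≠ ⊤) (r : ℝ)
    (b d : ℝ≥0∞) : b / x * d = b / x ^ r * (x ^ r * d) / x := by
  have h0 : x ^ r ≠ 0 := by simp [hx, hx']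
  have ht : x ^ r ≠ ⊤ := by simp [hx, hx']
  calc b / x * d = (x ^ r * (x ^ r)⁻¹) * (b / x * d) := by
        rw [ENNReal.mul_inv_cancel h0 ht, one_mul]
    _ = _ := by simp only [div_eq_mul_inv]; ring

theorem normEmbedding_of_lintegral_lt_top (μ : Measure R) [SFinite μ] (B : YoungFunction)
    {r : ℝ} {s : ℝ≥0∞} (hr : 1 < r) (hrs : ENNReal.ofReal r < s)
    (h : ∫⁻ t in Ioi ((μ univ)⁻¹.toReal),
        (B.toFun (ENNReal.ofReal t) / ENNReal.ofReal t ^ r) ^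
          (if s = ⊤ then (1 : ℝ) else s.toReal / (s.toReal - r)) / ENNReal.ofReal t < ⊤) :
    NormEmbedding μ (lorentzNorm μ (ENNReal.ofReal r) s) (luxNorm μ B) := by
  have hr0 : 0 < r := zero_lt_one.trans hr
  have hs0 : s ≠ 0 := (zero_le.trans_lt hrs).ne'
  set a : ℝ := (μ univ)⁻¹.toReal with hadef
  have ha : 0 ≤ a := ENNReal.toReal_nonneg
  set p : ℝ := if s = ⊤ then (1 : ℝ) else s.toReal / (s.toReal - r) with hpdef
  have hsr : s ≠ ⊤ → r < s.toReal := fun hs => (ENNReal.ofReal_lt_iff_lt_toReal hr0.le hs).1 hrs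
  have hp : 0 < p := by
    rw [hpdef]
    split_ifs with hs
    · exact zero_lt_one
    · exact div_pos (hr0.trans (hsr hs)) (sub_pos.2 (hsr hs))
  have hBfin := B.ne_top_of_lintegral_lt_top hr0.le hp h
  have hBm := B.measurable
  set I := ∫⁻ t in Ioi a, (B.toFun (ENNReal.ofReal t) / ENNReal.ofReal t ^ r) ^ p
    / ENNReal.ofReal t with hI
  set K₁ : ℝ≥0∞ := B.toFun (ENNReal.ofReal a) / ENNReal.ofReal a * μ univ * ENNReal.ofReal a
    with hK₁
  have hK₁top : K₁ ≠ ⊤ := by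
    rcases ha.eq_or_lt with ha0 | ha0
    · simp [hK₁, ← ha0]
    · have hμ : μ univ ≠ ⊤ := by
        intro hμ
        simp [hadef, hμ] at ha0
      exact ENNReal.mul_ne_top (ENNReal.mul_ne_top
        (ENNReal.div_ne_top (hBfin a) (by simpa using ha0)) hμ) ENNReal.ofReal_ne_top
  refine normEmbedding_of_lintegral_le hs0 (K := K₁ + I ^ (1 / p))
    (ENNReal.add_ne_top.2 ⟨hK₁top, ENNReal.rpow_ne_top_of_nonneg (by positivity) h.ne⟩)
    fun f hf hnorm => (lintegral_half_le_lintegral_mul_distFn μ B hf).trans ?_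
  have hDm : Measurable fun l : ℝ => distFn μ f (ENNReal.ofReal l) :=
    (measurable_distFn μ f).comp ENNReal.measurable_ofReal
  rw [← Ioc_union_Ioi_eq_Ioi ha]
  refine (lintegral_union_le _ _ _).trans (add_le_add ?_ ?_)
  · calc _ ≤ ∫⁻ _ in Ioc 0 a, B.toFun (ENNReal.ofReal a) / ENNReal.ofReal a * μ univ := by
          refine setLIntegral_mono' measurableSet_Ioc fun t ht => ?_
          exact mul_le_mul' (B.div_le_div (by simpa using ht.1) (ENNReal.ofReal_le_ofReal ht.2)
            ENNReal.ofReal_ne_top) (measure_mono (subset_univ _))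
      _ = K₁ := by rw [setLIntegral_const, Real.volume_Ioc, sub_zero]
  have hpos : ∀ {t : ℝ}, t ∈ Ioi a → ENNReal.ofReal t ≠ 0 := fun {t} ht => by
    simpa using ha.trans_lt ht
  rcases eq_or_ne s ⊤ with hs | hs
  · have hp1 : p = 1 := if_pos hs
    rw [hp1, div_one, ENNReal.rpow_one]
    refine setLIntegral_mono' measurableSet_Ioi fun t ht => ?_
    have ht0 : 0 < t := ha.trans_lt ht
    rw [hs] at hnorm
    have hD := (lorentzNorm_top_le_iff μ f hr0 one_ne_zero one_ne_top).1 hnorm t ht0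
    have hle : ENNReal.ofReal t ^ r * distFn μ f (ENNReal.ofReal t) ≤ 1 := by
      have h0 : ENNReal.ofReal t ^ r ≠ 0 := by simp [ht0]
      have h1 : ENNReal.ofReal t ^ r ≠ ⊤ :=
        ENNReal.rpow_ne_top_of_nonneg hr0.le ENNReal.ofReal_ne_top
      rw [mul_comm, ← ENNReal.le_div_iff_mul_le (Or.inl h0) (Or.inl h1)]
      rwa [ENNReal.div_rpow_of_nonneg _ _ hr0.le, ENNReal.one_rpow] at hD
    rw [ENNReal.div_mul_eq_div_rpow_mul_div (hpos ht) ENNReal.ofReal_ne_top r, hp1,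
      ENNReal.rpow_one]
    gcongr
    exact mul_le_of_le_one_right' hle
  · have hs1 := hsr hs
    have hσ : 0 < s.toReal := hr0.trans hs1
    have hp1 : p = s.toReal / (s.toReal - r) := if_neg hs
    have hpq : p.HolderConjugate (s.toReal / r) := by
      rw [Real.holderConjugate_iff, hp1]
      refine ⟨(one_lt_div (sub_pos.2 hs1)).2 (by linarith), ?_⟩
      field_simp
      ring
    have hI₂ : ∫⁻ t in Ioi a, (ENNReal.ofReal t ^ r * distFn μ f (ENNReal.ofReal t)) ^
        (s.toReal / r) / ENNReal.ofReal t ≤ 1 := by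
      calc _ ≤ ∫⁻ t in Ioi 0, (ENNReal.ofReal t ^ r * distFn μ f (ENNReal.ofReal t)) ^
            (s.toReal / r) / ENNReal.ofReal t := lintegral_mono_set (Ioi_subset_Ioi ha)
        _ = ∫⁻ t in Ioi 0, ENNReal.ofReal t ^ s.toReal * distFn μ f (ENNReal.ofReal t) ^
            (s.toReal / r) / ENNReal.ofReal t := by
            refine lintegral_congr fun t => ?_
            rw [ENNReal.mul_rpow_of_nonneg _ _ (div_pos hσ hr0).le, ← ENNReal.rpow_mul,
              mul_div_cancel₀ _ hr0.ne']
        _ ≤ ENNReal.ofReal r * _ := le_mul_of_one_le_left' (by simpa using hr.le)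
        _ = lorentzNorm μ (ENNReal.ofReal r) s f ^ s.toReal := (lorentzNorm_rpow μ f hr0 hs0 hs).symm
        _ ≤ 1 := ENNReal.rpow_le_one hnorm hσ.le
    calc _ = ∫⁻ t in Ioi a, B.toFun (ENNReal.ofReal t) / ENNReal.ofReal t ^ r *
          (ENNReal.ofReal t ^ r * distFn μ f (ENNReal.ofReal t)) / ENNReal.ofReal t :=
          setLIntegral_congr_fun measurableSet_Ioi fun t ht =>
            ENNReal.div_mul_eq_div_rpow_mul_div (hpos ht) ENNReal.ofReal_ne_top r _ _
      _ ≤ _ := ENNReal.lintegral_mul_div_le_Lp_mul_Lq _ hpq (by fun_prop) (by fun_prop)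
          (by fun_prop) ((ae_restrict_mem measurableSet_Ioi).mono fun t ht => hpos ht)
          fun _ => ENNReal.ofReal_ne_top
      _ ≤ I ^ (1 / p) * 1 := by
          gcongr
          exact ENNReal.rpow_le_one hI₂ (by positivity)
      _ = _ := mul_one _

theorem exists_forall_lintegral_mul_distFn_le_one {μ : Measure R} [SFinite μ] {B : YoungFunction}
    {N : (R → ℝ) → ℝ≥0∞} (h : NormEmbedding μ N (luxNorm μ B)) :
    ∃ k : ℝ≥0∞, k ≠ 0 ∧ k ≠ ⊤ ∧ ∀ f : R → ℝ, Measurable f → N f ≤ k →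
      ∫⁻ t in Ioi (0 : ℝ), B.toFun (ENNReal.ofReal t) / ENNReal.ofReal t *
        distFn μ f (ENNReal.ofReal t) ≤ 1 := by
  obtain ⟨C, hC, hemb⟩ := h
  have hC0 : ENNReal.ofReal C ≠ 0 := by simpa using hC
  refine ⟨2⁻¹ / ENNReal.ofReal C, (ENNReal.div_pos (by simp) ENNReal.ofReal_ne_top).ne',
    ENNReal.div_ne_top (by simp) hC0, fun f hf hN => ?_⟩
  refine (lintegral_mul_distFn_le μ B hf).trans (lintegral_le_one_of_luxNorm_lt_one ?_)
  calc luxNorm μ B f ≤ ENNReal.ofReal C * (2⁻¹ / ENNReal.ofReal C) :=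
        (hemb f hf).trans (by gcongr)
    _ = 2⁻¹ := ENNReal.mul_div_cancel hC0 ENNReal.ofReal_ne_top
    _ < 1 := by simp

theorem NonAtomic.setLIntegral_div_mul_le_one {μ : Measure R} (hna : NonAtomic μ)
    {B : YoungFunction} {G : ℝ≥0∞ → ℝ≥0∞} (hG : Antitone G)
    (h : ∀ f : R → ℝ, Measurable f → (∀ l, distFn μ f l ≤ G l) →
      ∫⁻ t in Ioi (0 : ℝ), B.toFun (ENNReal.ofReal t) / ENNReal.ofReal t *
        distFn μ f (ENNReal.ofReal t) ≤ 1)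
    {a : ℝ} (ha : 0 < a) (hGa : G (ENNReal.ofReal a) ≤ μ univ) :
    ∫⁻ t in Ioi a, B.toFun (ENNReal.ofReal t) / ENNReal.ofReal t *
      G (2 * ENNReal.ofReal t) ≤ 1 := by
  have hU : Ioi a = ⋃ n : ℕ, Ioo a n := by
    ext t
    simp only [mem_Ioi, mem_iUnion, mem_Ioo, exists_and_left]
    exact ⟨fun ht => ⟨ht, exists_nat_gt t⟩, fun ht => ht.1⟩
  have hmono : Monotone fun n : ℕ => Ioo a (n : ℝ) :=
    fun m n hmn => Ioo_subset_Ioo_right (by exact_mod_cast hmn)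
  rw [hU, setLIntegral_iUnion_of_directed _ hmono.directed_le]
  refine iSup_le fun n => ?_
  obtain ⟨f, hf, hfG, hGf⟩ := hna.exists_distFn_between hG (a := ENNReal.ofReal a)
    (b := ENNReal.ofReal n) (by simpa using ha) ENNReal.ofReal_ne_top ENNReal.ofReal_ne_top hGa
  calc _ ≤ ∫⁻ t in Ioo a n, B.toFun (ENNReal.ofReal t) / ENNReal.ofReal t *
        distFn μ f (ENNReal.ofReal t) := by
        refine setLIntegral_mono' measurableSet_Ioo fun t ht => ?_
        refine mul_le_mul_right (hGf _ (ENNReal.ofReal_le_ofReal ht.1.le) ?_) _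
        exact (ENNReal.ofReal_lt_ofReal_iff_of_nonneg (ha.trans ht.1).le).2 ht.2
    _ ≤ _ := lintegral_mono_set fun t ht => ha.trans ht.1
    _ ≤ 1 := h f hf hfG

theorem NonAtomic.lintegral_le_of_forall_weak {μ : Measure R} (hna : NonAtomic μ)
    {B : YoungFunction} {r : ℝ} (hr : 0 < r) {k : ℝ≥0∞} (hk : k ≠ 0) (hk' : k ≠ ⊤)
    (h : ∀ f : R → ℝ, Measurable f → lorentzNorm μ (ENNReal.ofReal r) ⊤ f ≤ k →
      ∫⁻ t in Ioi (0 : ℝ), B.toFun (ENNReal.ofReal t) / ENNReal.ofReal t *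
        distFn μ f (ENNReal.ofReal t) ≤ 1)
    {a : ℝ} (ha : 0 < a) (hka : (k / ENNReal.ofReal a) ^ r ≤ μ univ) :
    ∫⁻ t in Ioi a, B.toFun (ENNReal.ofReal t) / ENNReal.ofReal t ^ r / ENNReal.ofReal t ≤
      ((k / 2) ^ r)⁻¹ := by
  have hBm := B.measurable
  have hG : Antitone fun l : ℝ≥0∞ => (k / l) ^ r := fun x y hxy =>
    ENNReal.rpow_le_rpow (ENNReal.div_le_div_left hxy _) hr.le
  have key := hna.setLIntegral_div_mul_le_one (B := B) hG (fun f hf hfG => h f hf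
    ((lorentzNorm_top_le_iff μ f hr hk hk').2 fun l _ => hfG _)) ha hka
  have hc0 : (k / 2) ^ r ≠ 0 := by
    simp [hk, hk', hr, ENNReal.div_eq_top]
  have hct : (k / 2) ^ r ≠ ⊤ :=
    ENNReal.rpow_ne_top_of_nonneg hr.le (ENNReal.div_ne_top hk' two_ne_zero)
  rw [← one_div, ENNReal.le_div_iff_mul_le (Or.inl hc0) (Or.inl hct), mul_comm,
    ← lintegral_const_mul _ (by fun_prop)]
  refine le_trans (le_of_eq (setLIntegral_congr_fun measurableSet_Ioi fun t ht => ?_)) key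
  have ht0 : ENNReal.ofReal t ≠ 0 := by simpa using ha.trans ht
  have : k / (2 * ENNReal.ofReal t) = k / 2 / ENNReal.ofReal t := by
    simp only [div_eq_mul_inv]
    rw [ENNReal.mul_inv (Or.inr ENNReal.ofReal_ne_top) (Or.inr ht0), mul_assoc]
  rw [this, ENNReal.div_rpow_of_nonneg (k / 2) (ENNReal.ofReal t) hr.le]
  simp only [div_eq_mul_inv]
  ring

/-- The weighted tail `l ↦ ∫_{u > l} u^{-σ} w(u) du/u`. -/
def weightedTail (w : ℝ → ℝ≥0∞) (σ : ℝ) (l : ℝ≥0∞) : ℝ≥0∞ :=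
  ∫⁻ u in Ioi (0 : ℝ), if l < ENNReal.ofReal u then
    (ENNReal.ofReal u ^ σ)⁻¹ * (w u / ENNReal.ofReal u) else 0

theorem weightedTail_antitone (w : ℝ → ℝ≥0∞) (σ : ℝ) : Antitone (weightedTail w σ) := by
  intro l m hlm
  refine lintegral_mono fun u => ?_
  by_cases hm : m < ENNReal.ofReal u
  · simp [hm, hlm.trans_lt hm]
  · simp [hm]

theorem weightedTail_le (w : ℝ → ℝ≥0∞) {σ : ℝ} (hσ : 0 ≤ σ) {l : ℝ≥0∞} (hl : l ≠ 0) :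
    weightedTail w σ l ≤ (l ^ σ)⁻¹ * ∫⁻ u in Ioi (0 : ℝ), w u / ENNReal.ofReal u := by
  rw [← lintegral_const_mul' _ _ (by simp [hl, hσ])]
  refine lintegral_mono fun u => ?_
  split_ifs with h
  · gcongr
  · exact zero_le

theorem lintegral_rpow_mul_weightedTail {w : ℝ → ℝ≥0∞} (hw : Measurable w) {σ : ℝ} (hσ : 0 < σ) :
    ∫⁻ l in Ioi (0 : ℝ), ENNReal.ofReal l ^ σ / ENNReal.ofReal l *
        weightedTail w σ (ENNReal.ofReal l) =
      (ENNReal.ofReal σ)⁻¹ * ∫⁻ u in Ioi (0 : ℝ), w u / ENNReal.ofReal u := by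
  have hite : ∀ l : ℝ, Measurable fun u : ℝ => if ENNReal.ofReal l < ENNReal.ofReal u then
      (ENNReal.ofReal u ^ σ)⁻¹ * (w u / ENNReal.ofReal u) else 0 := fun l =>
    Measurable.ite (measurableSet_lt (by fun_prop) (by fun_prop)) (by fun_prop) measurable_const
  calc _ = ∫⁻ l in Ioi (0 : ℝ), ∫⁻ u in Ioi (0 : ℝ), ENNReal.ofReal l ^ σ / ENNReal.ofReal l *
        (if ENNReal.ofReal l < ENNReal.ofReal u then
          (ENNReal.ofReal u ^ σ)⁻¹ * (w u / ENNReal.ofReal u) else 0) :=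
        lintegral_congr fun l => (lintegral_const_mul _ (hite l)).symm
    _ = ∫⁻ u in Ioi (0 : ℝ), ∫⁻ l in Ioi (0 : ℝ), ENNReal.ofReal l ^ σ / ENNReal.ofReal l *
        (if ENNReal.ofReal l < ENNReal.ofReal u then
          (ENNReal.ofReal u ^ σ)⁻¹ * (w u / ENNReal.ofReal u) else 0) := by
        refine lintegral_lintegral_swap (Measurable.aemeasurable (Measurable.mul (by fun_prop) ?_))
        exact Measurable.ite (measurableSet_lt (by fun_prop) (by fun_prop)) (by fun_prop)
          measurable_const
    _ = ∫⁻ u in Ioi (0 : ℝ), (ENNReal.ofReal σ)⁻¹ * (w u / ENNReal.ofReal u) := by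
        refine setLIntegral_congr_fun measurableSet_Ioi fun u hu => ?_
        have hu0 : ENNReal.ofReal u ^ σ ≠ 0 := by simp [mem_Ioi.1 hu]
        have hut : ENNReal.ofReal u ^ σ ≠ ⊤ :=
          ENNReal.rpow_ne_top_of_nonneg hσ.le ENNReal.ofReal_ne_top
        calc _ = ∫⁻ l in Ioi (0 : ℝ), (ENNReal.ofReal u ^ σ)⁻¹ * (w u / ENNReal.ofReal u) *
              (if ENNReal.ofReal l < ENNReal.ofReal u then
                ENNReal.ofReal l ^ σ / ENNReal.ofReal l else 0) := by
              refine lintegral_congr fun l => ?_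
              split_ifs <;> ring
          _ = (ENNReal.ofReal u ^ σ)⁻¹ * (w u / ENNReal.ofReal u) *
              (ENNReal.ofReal u ^ σ / ENNReal.ofReal σ) := by
              rw [lintegral_const_mul _ (Measurable.ite (measurableSet_lt (by fun_prop)
                (by fun_prop)) (by fun_prop) measurable_const),
                ENNReal.lintegral_ite_lt_rpow_div hσ]
          _ = (ENNReal.ofReal u ^ σ * (ENNReal.ofReal u ^ σ)⁻¹) *
              ((ENNReal.ofReal σ)⁻¹ * (w u / ENNReal.ofReal u)) := by
              simp only [div_eq_mul_inv]
              ring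
          _ = _ := by rw [ENNReal.mul_inv_cancel hu0 hut, one_mul]
    _ = _ := lintegral_const_mul _ (by fun_prop)

/-- Lower bound of the tail for a weight of the form `(b(u) / u^r)^p` with `b` non-decreasing. -/
theorem le_weightedTail_two_mul {b : ℝ → ℝ≥0∞} (hb : Monotone b) {r p σ : ℝ} (hr : 0 ≤ r)
    (hp : 0 ≤ p) (hσ : 0 ≤ σ) {t : ℝ} (ht : 0 < t) :
    (4 ^ σ * (4 ^ r) ^ p * 2)⁻¹ * ((ENNReal.ofReal t ^ σ)⁻¹ * (b t / ENNReal.ofReal t ^ r) ^ p) ≤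
      weightedTail (fun u => (b u / ENNReal.ofReal u ^ r) ^ p) σ (2 * ENNReal.ofReal t) := by
  have h2 : 2 * ENNReal.ofReal t = ENNReal.ofReal (2 * t) := by
    rw [ENNReal.ofReal_mul two_pos.le, ENNReal.ofReal_ofNat]
  have h4 : ENNReal.ofReal (4 * t) = 4 * ENNReal.ofReal t := by
    rw [ENNReal.ofReal_mul four_pos.le, ENNReal.ofReal_ofNat]
  have ht0 : ENNReal.ofReal t ≠ 0 := by simpa using ht
  have h40 : (4 : ℝ≥0∞) ≠ 0 := four_ne_zero
  have h4t : (4 : ℝ≥0∞) ≠ ⊤ := by simp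
  have hpow : ∀ {x : ℝ≥0∞} {c : ℝ}, x ≠ 0 → x ≠ ⊤ → x ^ c ≠ 0 := fun h h' => by simp [h, h']
  have hpow' : ∀ {x : ℝ≥0∞} {c : ℝ}, x ≠ 0 → x ≠ ⊤ → x ^ c ≠ ⊤ := fun h h' => by simp [h, h']
  have hT := @ENNReal.ofReal_ne_top t
  have h42 : (4 : ℝ≥0∞)⁻¹ * 2 = 2⁻¹ := by
    have : (4 : ℝ≥0∞) = 2 * 2 := by norm_num
    rw [this, ENNReal.mul_inv (by simp) (by simp), mul_assoc,
      ENNReal.inv_mul_cancel (by simp) (by simp), mul_one]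
  calc _ = ((4 * ENNReal.ofReal t) ^ σ)⁻¹ * ((b t / (4 * ENNReal.ofReal t) ^ r) ^ p /
          (4 * ENNReal.ofReal t)) * (2 * ENNReal.ofReal t) := by
        rw [ENNReal.mul_rpow_of_nonneg _ _ hσ, ENNReal.mul_rpow_of_nonneg _ _ hr,
          ENNReal.div_rpow_of_nonneg _ _ hp, ENNReal.div_rpow_of_nonneg _ _ hp,
          ENNReal.mul_rpow_of_nonneg _ _ hp]
        simp only [div_eq_mul_inv]
        rw [ENNReal.mul_inv (Or.inr (by simp)) (Or.inr (by simp)),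
          ENNReal.mul_inv (Or.inl (hpow h40 h4t)) (Or.inl (hpow' h40 h4t)),
          ENNReal.mul_inv (Or.inl (hpow h40 h4t)) (Or.inl (hpow' h40 h4t)),
          ENNReal.mul_inv (Or.inl (hpow (hpow h40 h4t) (hpow' h40 h4t)))
            (Or.inl (hpow' (hpow h40 h4t) (hpow' h40 h4t))),
          ENNReal.mul_inv (Or.inl h40) (Or.inl h4t), ← h42]
        calc _ = (4 ^ σ)⁻¹ * ((4 ^ r) ^ p)⁻¹ * (4⁻¹ * 2) * ((ENNReal.ofReal t ^ σ)⁻¹ *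
              (b t ^ p * ((ENNReal.ofReal t ^ r) ^ p)⁻¹)) *
              ((ENNReal.ofReal t)⁻¹ * ENNReal.ofReal t) := by
              rw [ENNReal.inv_mul_cancel ht0 hT, mul_one]
          _ = _ := by ring
    _ = ∫⁻ _ in Ioo (2 * t) (4 * t), ((4 * ENNReal.ofReal t) ^ σ)⁻¹ *
          ((b t / (4 * ENNReal.ofReal t) ^ r) ^ p / (4 * ENNReal.ofReal t)) := by
        rw [setLIntegral_const, Real.volume_Ioo, h2]
        congr 2
        ring
    _ ≤ ∫⁻ u in Ioo (2 * t) (4 * t), if 2 * ENNReal.ofReal t < ENNReal.ofReal u then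
          (ENNReal.ofReal u ^ σ)⁻¹ * ((b u / ENNReal.ofReal u ^ r) ^ p / ENNReal.ofReal u)
          else 0 := by
        refine setLIntegral_mono' measurableSet_Ioo fun u hu => ?_
        have hu4 : ENNReal.ofReal u ≤ 4 * ENNReal.ofReal t := by
          rw [← h4]
          exact ENNReal.ofReal_le_ofReal hu.2.le
        have hbu : b t ≤ b u := hb (by linarith [hu.1])
        rw [h2, if_pos ((ENNReal.ofReal_lt_ofReal_iff_of_nonneg (by linarith)).2 hu.1)]
        gcongr
    _ ≤ _ := lintegral_mono_set fun u hu => lt_trans (by positivity) hu.1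

theorem NonAtomic.lintegral_le_of_forall_lorentz_of_monotone {μ : Measure R} (hna : NonAtomic μ)
    {B : YoungFunction} {r : ℝ} (hr : 0 < r) {s : ℝ≥0∞} (hs : s ≠ ⊤) (hrs : r < s.toReal)
    {k : ℝ≥0∞} (hk : k ≠ 0) (hk' : k ≠ ⊤)
    (h : ∀ f : R → ℝ, Measurable f → lorentzNorm μ (ENNReal.ofReal r) s f ≤ k →
      ∫⁻ t in Ioi (0 : ℝ), B.toFun (ENNReal.ofReal t) / ENNReal.ofReal t *
        distFn μ f (ENNReal.ofReal t) ≤ 1)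
    {p : ℝ} (hp : p = s.toReal / (s.toReal - r))
    {a : ℝ} (ha : 0 < a) (hka : (k / ENNReal.ofReal a) ^ r ≤ μ univ)
    {b : ℝ → ℝ≥0∞} (hb : Monotone b) (hbB : ∀ t, b t ≤ B.toFun (ENNReal.ofReal t))
    (hba : ∀ t ≤ a, b t = 0)
    (hI : ∫⁻ u in Ioi (0 : ℝ), (b u / ENNReal.ofReal u ^ r) ^ p / ENNReal.ofReal u ≠ ⊤) :
    ∫⁻ u in Ioi (0 : ℝ), (b u / ENNReal.ofReal u ^ r) ^ p / ENNReal.ofReal u ≤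
      ((k ^ r * ((4 ^ s.toReal * (4 ^ r) ^ p * 2)⁻¹) ^ (r / s.toReal))⁻¹) ^ p := by
  have hσ : 0 < s.toReal := hr.trans hrs
  have hs0 : s ≠ 0 := fun h0 => by simp [h0] at hσ
  set σ := s.toReal with hσdef
  have hσr : 0 < σ - r := sub_pos.2 hrs
  have hp0 : 0 < p := hp ▸ div_pos hσ hσr
  have hrσ : 0 < r / σ := div_pos hr hσ
  have hbm := hb.measurable
  set w : ℝ → ℝ≥0∞ := fun u => (b u / ENNReal.ofReal u ^ r) ^ p with hw
  have hwm : Measurable w := by fun_prop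
  set I := ∫⁻ u in Ioi (0 : ℝ), w u / ENNReal.ofReal u with hIdef
  set c : ℝ≥0∞ := (4 ^ σ * (4 ^ r) ^ p * 2)⁻¹ with hc
  rcases eq_or_ne I 0 with hI0 | hI0
  · rw [hI0]
    exact zero_le
  have hc0 : c ≠ 0 := by
    refine ENNReal.inv_ne_zero.2 (ENNReal.mul_ne_top (ENNReal.mul_ne_top ?_ ?_) (by simp))
    · exact ENNReal.rpow_ne_top_of_nonneg hσ.le (by simp)
    · exact ENNReal.rpow_ne_top_of_nonneg hp0.le (ENNReal.rpow_ne_top_of_nonneg hr.le (by simp))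
  have hct : c ≠ ⊤ := by
    refine ENNReal.inv_ne_top.2 (mul_ne_zero (mul_ne_zero ?_ ?_) two_ne_zero) <;> simp
  set G : ℝ≥0∞ → ℝ≥0∞ := fun l => k ^ r * (weightedTail w σ l / I) ^ (r / σ) with hGdef
  have hG : Antitone G := fun x y hxy => by
    have := weightedTail_antitone w σ hxy
    simp only [hGdef]
    gcongr
  have hGa : G (ENNReal.ofReal a) ≤ μ univ := by
    refine le_trans ?_ hka
    have hle : weightedTail w σ (ENNReal.ofReal a) / I ≤ (ENNReal.ofReal a ^ σ)⁻¹ :=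
      ENNReal.div_le_of_le_mul (weightedTail_le w hσ.le (by simpa using ha))
    calc G (ENNReal.ofReal a) ≤ k ^ r * ((ENNReal.ofReal a ^ σ)⁻¹) ^ (r / σ) := by
          simp only [hGdef]
          gcongr
      _ = (k / ENNReal.ofReal a) ^ r := by
          rw [ENNReal.inv_rpow, ← ENNReal.rpow_mul, mul_div_cancel₀ _ hσ.ne',
            ENNReal.div_rpow_of_nonneg _ _ hr.le, div_eq_mul_inv]
  have hnorm : ∀ f : R → ℝ, (∀ l, distFn μ f l ≤ G l) →
      lorentzNorm μ (ENNReal.ofReal r) s f ≤ k := by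
    intro f hf
    rw [← ENNReal.rpow_le_rpow_iff hσ, lorentzNorm_rpow μ f hr hs0 hs]
    have hpt : ∀ l : ℝ, ENNReal.ofReal l ^ σ * distFn μ f (ENNReal.ofReal l) ^ (σ / r) /
        ENNReal.ofReal l ≤ k ^ σ * I⁻¹ * (ENNReal.ofReal l ^ σ / ENNReal.ofReal l *
          weightedTail w σ (ENNReal.ofReal l)) := fun l => by
      calc _ ≤ ENNReal.ofReal l ^ σ * G (ENNReal.ofReal l) ^ (σ / r) / ENNReal.ofReal l := by
            gcongr
            exact hf _
        _ = _ := by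
            have h1 : r / σ * (σ / r) = 1 := by field_simp
            simp only [hGdef]
            rw [ENNReal.mul_rpow_of_nonneg _ _ (div_pos hσ hr).le, ← ENNReal.rpow_mul,
              ← ENNReal.rpow_mul, h1, ENNReal.rpow_one, mul_div_cancel₀ _ hr.ne']
            simp only [div_eq_mul_inv]
            ring
    calc _ ≤ ENNReal.ofReal r * ∫⁻ l in Ioi (0 : ℝ), k ^ σ * I⁻¹ *
          (ENNReal.ofReal l ^ σ / ENNReal.ofReal l * weightedTail w σ (ENNReal.ofReal l)) :=
          mul_le_mul_right (lintegral_mono hpt) _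
      _ = ENNReal.ofReal r * (k ^ σ * I⁻¹ * ((ENNReal.ofReal σ)⁻¹ * I)) := by
          rw [lintegral_const_mul' _ _ (ENNReal.mul_ne_top
            (ENNReal.rpow_ne_top_of_nonneg hσ.le hk') (ENNReal.inv_ne_top.2 hI0)),
            lintegral_rpow_mul_weightedTail hwm hσ]
      _ = ENNReal.ofReal r / ENNReal.ofReal σ * k ^ σ * (I⁻¹ * I) := by
          rw [div_eq_mul_inv]
          ring
      _ ≤ 1 * k ^ σ * 1 := by
          gcongr
          · exact ENNReal.div_le_of_le_mul (by simpa using ENNReal.ofReal_le_ofReal hrs.le)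
          · exact (ENNReal.inv_mul_cancel hI0 hI).le
      _ = k ^ σ := by rw [one_mul, mul_one]
  have key := hna.setLIntegral_div_mul_le_one (B := B) hG (fun f hf hfG => h f hf (hnorm f hfG))
    ha hGa
  have hIa : I = ∫⁻ u in Ioi a, w u / ENNReal.ofReal u := by
    rw [hIdef, ← Ioc_union_Ioi_eq_Ioi ha.le]
    rw [lintegral_union measurableSet_Ioi (Ioc_disjoint_Ioi le_rfl),
      setLIntegral_eq_zero measurableSet_Ioc (fun t ht => ?_), zero_add]
    simp [hw, hba t ht.2, hp0]
  set D : ℝ≥0∞ := k ^ r * c ^ (r / σ) with hD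
  have hD0 : D ≠ 0 := mul_ne_zero (by simp [hk, hk']) (by simp [hc0, hct])
  have hDt : D ≠ ⊤ := ENNReal.mul_ne_top (ENNReal.rpow_ne_top_of_nonneg hr.le hk')
    (ENNReal.rpow_ne_top_of_nonneg hrσ.le hct)
  have hIr0 : I ^ (r / σ) ≠ 0 := by simp [hI0, hI]
  have hIrt : I ^ (r / σ) ≠ ⊤ := ENNReal.rpow_ne_top_of_nonneg hrσ.le hI
  have hexp : 1 + p * (r / σ) = p := by
    rw [hp]
    field_simp
    ring
  have hlow : D * (I ^ (r / σ))⁻¹ * I ≤ 1 := by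
    refine le_trans ?_ key
    nth_rewrite 2 [hIa]
    rw [← lintegral_const_mul' _ _ (ENNReal.mul_ne_top hDt (ENNReal.inv_ne_top.2 hIr0))]
    refine setLIntegral_mono' measurableSet_Ioi fun t ht => ?_
    have ht0 : 0 < t := ha.trans ht
    have hx0 : ENNReal.ofReal t ^ r ≠ 0 := by simp [ht0]
    have hxt : ENNReal.ofReal t ^ r ≠ ⊤ := ENNReal.rpow_ne_top_of_nonneg hr.le ENNReal.ofReal_ne_top
    have htail := le_weightedTail_two_mul hb hr.le hp0.le hσ.le ht0
    have hwt : b t / ENNReal.ofReal t ^ r * w t ^ (r / σ) = w t := by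
      rw [hw, ← ENNReal.rpow_mul]
      nth_rewrite 1 [← ENNReal.rpow_one (b t / ENNReal.ofReal t ^ r)]
      rw [← ENNReal.rpow_add_of_nonneg _ _ zero_le_one (mul_pos hp0 hrσ).le, hexp]
    calc _ = b t / ENNReal.ofReal t * (k ^ r * ((c * ((ENNReal.ofReal t ^ σ)⁻¹ * w t)) / I) ^
          (r / σ)) := by
          rw [ENNReal.div_rpow_of_nonneg _ _ hrσ.le, ENNReal.mul_rpow_of_nonneg c _ hrσ.le,
            ENNReal.mul_rpow_of_nonneg _ (w t) hrσ.le, ENNReal.inv_rpow (ENNReal.ofReal t ^ σ),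
            ← ENNReal.rpow_mul (ENNReal.ofReal t) σ, mul_div_cancel₀ _ hσ.ne', hD]
          nth_rewrite 1 [← hwt]
          simp only [div_eq_mul_inv]
          ring
      _ ≤ _ := by
          refine mul_le_mul' (ENNReal.div_le_div_right (hbB t) _) ?_
          simp only [hGdef]
          gcongr
  have h1 : I ^ (r / σ) * I ^ (1 - r / σ) = I := by
    rw [← ENNReal.rpow_add _ _ hI0 hI, add_sub_cancel, ENNReal.rpow_one]
  have h2 : I ^ (1 - r / σ) ≤ D⁻¹ := by
    rw [ENNReal.le_inv_iff_mul_le, mul_comm]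
    calc D * I ^ (1 - r / σ) = D * ((I ^ (r / σ))⁻¹ * I ^ (r / σ)) * I ^ (1 - r / σ) := by
          rw [ENNReal.inv_mul_cancel hIr0 hIrt, mul_one]
      _ = D * (I ^ (r / σ))⁻¹ * (I ^ (r / σ) * I ^ (1 - r / σ)) := by ring
      _ ≤ 1 := by rwa [h1]
  calc I = (I ^ (1 - r / σ)) ^ p := by
        have : (1 - r / σ) * p = 1 := by
          rw [hp]
          field_simp
        rw [← ENNReal.rpow_mul, this, ENNReal.rpow_one]
    _ ≤ D⁻¹ ^ p := ENNReal.rpow_le_rpow h2 hp0.le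

theorem ENNReal.lintegral_Ioi_const_div_rpow_lt_top {r p a : ℝ} (hr : 0 < r) (hp : 0 < p)
    (ha : 0 < a) {M : ℝ≥0∞} (hM : M ≠ ⊤) :
    ∫⁻ u in Ioi a, (M / ENNReal.ofReal u ^ r) ^ p / ENNReal.ofReal u < ⊤ := by
  have hint : IntegrableOn (fun u : ℝ => u ^ (-(r * p) - 1)) (Ioi a) :=
    integrableOn_Ioi_rpow_of_lt (by linarith [_root_.mul_pos hr hp]) ha
  calc _ = ∫⁻ u in Ioi a, M ^ p * ENNReal.ofReal (u ^ (-(r * p) - 1)) := by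
        refine setLIntegral_congr_fun measurableSet_Ioi fun u hu => ?_
        have hu0 : 0 < u := ha.trans hu
        have hu1 : ENNReal.ofReal u ≠ 0 := by simpa using hu0
        have : ENNReal.ofReal (u ^ (-(r * p) - 1)) =
            (ENNReal.ofReal u ^ (r * p))⁻¹ * (ENNReal.ofReal u)⁻¹ := by
          rw [← ENNReal.ofReal_rpow_of_pos hu0, sub_eq_add_neg,
            ENNReal.rpow_add _ _ hu1 ENNReal.ofReal_ne_top, ENNReal.rpow_neg, ENNReal.rpow_neg,
            ENNReal.rpow_one]
        rw [this, ENNReal.div_rpow_of_nonneg _ _ hp.le, ← ENNReal.rpow_mul]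
        simp only [div_eq_mul_inv, mul_assoc]
    _ = M ^ p * ∫⁻ u in Ioi a, ENNReal.ofReal (u ^ (-(r * p) - 1)) :=
        lintegral_const_mul' _ _ (ENNReal.rpow_ne_top_of_nonneg hp.le hM)
    _ < ⊤ := by
        refine ENNReal.mul_lt_top (ENNReal.rpow_lt_top_of_nonneg hp.le hM) ?_
        exact hint.lintegral_lt_top

theorem NonAtomic.lintegral_le_of_forall_lorentz {μ : Measure R} (hna : NonAtomic μ)
    {B : YoungFunction} {r : ℝ} (hr : 0 < r) {s : ℝ≥0∞} (hs : s ≠ ⊤) (hrs : r < s.toReal)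
    {k : ℝ≥0∞} (hk : k ≠ 0) (hk' : k ≠ ⊤)
    (h : ∀ f : R → ℝ, Measurable f → lorentzNorm μ (ENNReal.ofReal r) s f ≤ k →
      ∫⁻ t in Ioi (0 : ℝ), B.toFun (ENNReal.ofReal t) / ENNReal.ofReal t *
        distFn μ f (ENNReal.ofReal t) ≤ 1)
    {p : ℝ} (hp : p = s.toReal / (s.toReal - r))
    {a : ℝ} (ha : 0 < a) (hka : (k / ENNReal.ofReal a) ^ r ≤ μ univ) :
    ∫⁻ u in Ioi a, (B.toFun (ENNReal.ofReal u) / ENNReal.ofReal u ^ r) ^ p / ENNReal.ofReal u ≤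
      ((k ^ r * ((4 ^ s.toReal * (4 ^ r) ^ p * 2)⁻¹) ^ (r / s.toReal))⁻¹) ^ p := by
  have hp0 : 0 < p := hp ▸ div_pos (hr.trans hrs) (sub_pos.2 hrs)
  have hBm := B.measurable
  have hlim : Tendsto (fun n : ℕ => ∫⁻ u in Ioi a,
      (min (B.toFun (ENNReal.ofReal u)) n / ENNReal.ofReal u ^ r) ^ p / ENNReal.ofReal u) atTop
      (nhds (∫⁻ u in Ioi a,
        (B.toFun (ENNReal.ofReal u) / ENNReal.ofReal u ^ r) ^ p / ENNReal.ofReal u)) := by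
    refine lintegral_tendsto_of_tendsto_of_monotone
      (fun n => Measurable.aemeasurable (by fun_prop)) (ae_of_all _ fun u m n hmn => ?_) ?_
    · dsimp only
      gcongr
    · filter_upwards [ae_restrict_mem measurableSet_Ioi] with u hu
      have hu0 : 0 < u := ha.trans hu
      refine ENNReal.Tendsto.div_const (Tendsto.ennrpow_const p
        (ENNReal.Tendsto.div_const (m := fun n : ℕ => min (B.toFun (ENNReal.ofReal u)) n) ?_ ?_)) ?_
      · simpa using (tendsto_const_nhds (x := B.toFun (ENNReal.ofReal u))).min
          ENNReal.tendsto_nat_nhds_top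
      · right; simp [hu0]
      · right; simpa using hu0
  refine le_of_tendsto' hlim fun n => ?_
  set b : ℝ → ℝ≥0∞ := (Ioi a).indicator fun u => min (B.toFun (ENNReal.ofReal u)) n with hb
  have hIeq : ∫⁻ u in Ioi (0 : ℝ), (b u / ENNReal.ofReal u ^ r) ^ p / ENNReal.ofReal u =
      ∫⁻ u in Ioi a, (min (B.toFun (ENNReal.ofReal u)) n / ENNReal.ofReal u ^ r) ^ p /
        ENNReal.ofReal u := by
    rw [← Ioc_union_Ioi_eq_Ioi ha.le, lintegral_union measurableSet_Ioi (Ioc_disjoint_Ioi le_rfl),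
      setLIntegral_eq_zero measurableSet_Ioc (fun t ht => ?_), zero_add]
    · refine setLIntegral_congr_fun measurableSet_Ioi fun u hu => ?_
      simp only [hb, indicator_of_mem hu]
    · have : t ∉ Ioi a := not_lt.2 ht.2
      simp [hb, this, hp0]
  rw [← hIeq]
  refine hna.lintegral_le_of_forall_lorentz_of_monotone hr hs hrs hk hk' h hp ha hka
    (fun x y hxy => ?_) (fun t => ?_) (fun t ht => ?_) ?_
  · by_cases hx : x ∈ Ioi a
    · have hy : y ∈ Ioi a := lt_of_lt_of_le hx hxy
      simp only [hb, indicator_of_mem hx, indicator_of_mem hy]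
      exact min_le_min_right _ (B.mono (ENNReal.ofReal_le_ofReal hxy))
    · simp [hb, indicator_of_notMem hx]
  · exact indicator_le' (fun _ _ => min_le_left _ _) (fun _ _ => zero_le) t
  · exact indicator_of_notMem (not_lt.2 ht) _
  · rw [hIeq]
    refine ((lintegral_mono fun u => ?_).trans_lt
      (ENNReal.lintegral_Ioi_const_div_rpow_lt_top hr hp0 ha (natCast_ne_top n))).ne
    dsimp only
    gcongr
    exact min_le_right _ _

theorem lintegral_Ioi_inv_measure_lt_top {μ : Measure R} (hpos : 0 < μ univ) (B : YoungFunction)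
    {r p : ℝ} (hr : 0 < r) (hp : 0 < p) {k M : ℝ≥0∞} (hk : k ≠ ⊤) (hM : M ≠ ⊤)
    (h : ∀ a : ℝ, 0 < a → (k / ENNReal.ofReal a) ^ r ≤ μ univ →
      ∫⁻ t in Ioi a, (B.toFun (ENNReal.ofReal t) / ENNReal.ofReal t ^ r) ^ p
        / ENNReal.ofReal t ≤ M) :
    ∫⁻ t in Ioi ((μ univ)⁻¹.toReal), (B.toFun (ENNReal.ofReal t) / ENNReal.ofReal t ^ r) ^ p
      / ENNReal.ofReal t < ⊤ := by
  rcases eq_or_ne (μ univ) ⊤ with hμ | hμ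
  · have hU : Ioi (0 : ℝ) = ⋃ n : ℕ, Ioi (1 / ((n : ℝ) + 1)) := by
      ext t
      simp only [mem_Ioi, mem_iUnion]
      exact ⟨exists_nat_one_div_lt, fun ⟨n, hn⟩ => lt_trans (by positivity) hn⟩
    have hmono : Monotone fun n : ℕ => Ioi (1 / ((n : ℝ) + 1)) := fun m n hmn =>
      Ioi_subset_Ioi (one_div_le_one_div_of_le (by positivity) (by gcongr))
    rw [hμ, ENNReal.inv_top, ENNReal.toReal_zero, hU,
      setLIntegral_iUnion_of_directed _ hmono.directed_le]
    refine (iSup_le fun n => ?_).trans_lt hM.lt_top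
    exact h _ (by positivity) (by simp [hμ])
  · set a := (μ univ)⁻¹.toReal with hadef
    have ha : 0 < a := ENNReal.toReal_pos (ENNReal.inv_ne_zero.2 hμ) (ENNReal.inv_ne_top.2 hpos.ne')
    set x : ℝ≥0∞ := k / μ univ ^ r⁻¹ with hx
    have hμ0 : μ univ ^ r⁻¹ ≠ 0 := by simp [hpos.ne', hμ]
    have hμt : μ univ ^ r⁻¹ ≠ ⊤ := by simp [hpos.ne', hμ]
    have hxt : x ≠ ⊤ := ENNReal.div_ne_top hk hμ0
    set c := max a x.toReal with hc
    have hac : a ≤ c := le_max_left _ _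
    have hc0 : 0 < c := ha.trans_le hac
    have htail := h c hc0 (by
      rw [← ENNReal.le_rpow_inv_iff hr]
      refine ENNReal.div_le_of_le_mul ?_
      rw [mul_comm]
      refine (ENNReal.div_le_iff hμ0 hμt).1 ?_
      rw [← hx, ← ENNReal.ofReal_toReal hxt]
      exact ENNReal.ofReal_le_ofReal (le_max_right _ _))
    have hBfin := B.ne_top_of_lintegral_lt_top hr.le hp (htail.trans_lt hM.lt_top)
    rw [← Ioc_union_Ioi_eq_Ioi hac]
    refine (lintegral_union_le _ _ _).trans_lt
      (ENNReal.add_lt_top.2 ⟨?_, htail.trans_lt hM.lt_top⟩)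
    calc _ ≤ ∫⁻ _ in Ioc a c, (B.toFun (ENNReal.ofReal c) / ENNReal.ofReal a ^ r) ^ p
          / ENNReal.ofReal a := by
          refine setLIntegral_mono' measurableSet_Ioc fun t ht => ?_
          have h1 := ENNReal.ofReal_le_ofReal ht.1.le
          have h2 := B.mono (ENNReal.ofReal_le_ofReal ht.2)
          exact ENNReal.div_le_div (ENNReal.rpow_le_rpow (ENNReal.div_le_div h2
            (ENNReal.rpow_le_rpow h1 hr.le)) hp.le) h1
      _ < ⊤ := by
          rw [setLIntegral_const, Real.volume_Ioc]
          refine ENNReal.mul_lt_top (ENNReal.div_lt_top (ENNReal.rpow_ne_top_of_nonneg hp.le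
            (ENNReal.div_ne_top (hBfin c) ?_)) ?_) ENNReal.ofReal_lt_top
          · simp [ha]
          · simpa using ha

/-- On a non-atomic σ-finite measure space of positive measure,
for a Young function `B` and `1 < r < s ≤ ∞`, the continuous embedding
`L^{r,s} ↪ L^B` holds iff `∫_{1/μ(R)}^∞ (B(t)/t^r)^{s/(s-r)} dt/t < ∞`,
where `s/(s-r)` is interpreted as `1` when `s = ∞`. -/
theorem lorentz_orlicz_embedding_iff_integral
    {R : Type*} [MeasurableSpace R] (μ : Measure R) [SigmaFinite μ]
    (hna : NonAtomic μ) (hpos : 0 < μ Set.univ)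
    (B : YoungFunction) (r : ℝ) (s : ℝ≥0∞) (hr : 1 < r) (hrs : ENNReal.ofReal r < s) :
    NormEmbedding μ (lorentzNorm μ (ENNReal.ofReal r) s) (luxNorm μ B) ↔
      ∫⁻ t in Set.Ioi ((μ Set.univ)⁻¹.toReal),
        (B.toFun (ENNReal.ofReal t) / ENNReal.ofReal t ^ r) ^
          (if s = ⊤ then (1:ℝ) else s.toReal / (s.toReal - r)) / ENNReal.ofReal t < ⊤ := by
  have hr0 : 0 < r := zero_lt_one.trans hr
  refine ⟨fun hemb => ?_, normEmbedding_of_lintegral_lt_top μ B hr hrs⟩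
  obtain ⟨k, hk, hk', h⟩ := exists_forall_lintegral_mul_distFn_le_one hemb
  split_ifs with hs
  · subst hs
    refine lintegral_Ioi_inv_measure_lt_top hpos B hr0 zero_lt_one hk'
      (M := ((k / 2) ^ r)⁻¹) ?_ fun a ha hka => ?_
    · refine ENNReal.inv_ne_top.2 ?_
      simp [hk, hk', hr0, ENNReal.div_eq_top]
    · simp only [ENNReal.rpow_one]
      exact hna.lintegral_le_of_forall_weak hr0 hk hk' h ha hka
  · have hsr : r < s.toReal := (ENNReal.ofReal_lt_iff_lt_toReal hr0.le hs).1 hrs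
    have hp0 : 0 < s.toReal / (s.toReal - r) := div_pos (hr0.trans hsr) (sub_pos.2 hsr)
    refine lintegral_Ioi_inv_measure_lt_top hpos B hr0 hp0 hk' ?_ fun a ha hka =>
      hna.lintegral_le_of_forall_lorentz hr0 hs hsr hk hk' h rfl ha hka
    refine ENNReal.rpow_ne_top_of_nonneg hp0.le (ENNReal.inv_ne_top.2 (mul_ne_zero ?_ ?_))
    · simp [hk, hk']
    · have hc : (4 ^ s.toReal * (4 ^ r) ^ (s.toReal / (s.toReal - r)) * 2 : ℝ≥0∞) ≠ ⊤ :=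
        ENNReal.mul_ne_top (ENNReal.mul_ne_top
          (ENNReal.rpow_ne_top_of_nonneg (hr0.trans hsr).le (by simp))
          (ENNReal.rpow_ne_top_of_nonneg hp0.le
            (ENNReal.rpow_ne_top_of_nonneg hr0.le (by simp)))) (by simp)
      rw [ENNReal.inv_rpow]
      exact ENNReal.inv_ne_zero.2
        (ENNReal.rpow_ne_top_of_nonneg (div_pos hr0 (hr0.trans hsr)).le hc)
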